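/- arXiv:1106.0877 — 3 statements merged into one kernel-verified Lean document; each statement's English description precedes it below -/
import Mathlib

section
/- Let μ be a probability measure on a complete separable metric space (X,d) and let α be a Young function. Suppose there exist constants τ, a, b > 0 and c ∈ [0,1) such that for every n ∈ ℕ* and every bounded continuous function f : X^n → [0,∞), ∫ e^{τ P_{α,n} f} dμ^n ≤ a · e^{b ∫ P_{α,n}f dμ^n} · e^{τ c ‖f‖_∞}, where P_{α,n} f(x) = sup_{y∈X^n} { f(y) − Σ_{i=1}^n α(d(x_i,y_i)) }. Then μ satisfies the transport-entropy inequality T_α( 1/(τ(1−c)) ). -/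
open MeasureTheory Filter Set Topology
open scoped ENNReal NNReal

noncomputable section

/-- The right derivative of a function `α : ℝ → ℝ`. -/
def rightD (α : ℝ → ℝ) (x : ℝ) : ℝ := derivWithin α (Set.Ioi x) x

/-- The left derivative of a function `α : ℝ → ℝ`. -/
def leftD (α : ℝ → ℝ) (x : ℝ) : ℝ := derivWithin α (Set.Iio x) x

/-- A Young function: an even, convex, nonnegative function, increasing on `[0,∞)`,
vanishing at `0` and with vanishing right derivative at `0`. -/
structure IsYoung (α : ℝ → ℝ) : Prop where
  nonneg : ∀ x, 0 ≤ α x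
  even : ∀ x, α (-x) = α x
  convex : ConvexOn ℝ Set.univ α
  mono : StrictMonoOn α (Set.Ici 0)
  zero : α 0 = 0
  rightD_zero : rightD α 0 = 0

/-- The Δ₂-condition for a Young function. -/
def DeltaTwo (α : ℝ → ℝ) : Prop := ∃ K > 0, ∀ x : ℝ, α (2 * x) ≤ K * α x

/-- `r_α = inf_{x>0} x α'₋(x)/α(x)`. -/
def rAlpha (α : ℝ → ℝ) : ℝ := sInf {r : ℝ | ∃ x > 0, r = x * leftD α x / α x}

/-- `p_α = sup_{x>0} x α'₊(x)/α(x)`. -/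
def pAlpha (α : ℝ → ℝ) : ℝ := sSup {r : ℝ | ∃ x > 0, r = x * rightD α x / α x}

/-- The Fenchel-Legendre transform `α*(y) = sup_x {xy - α(x)}`, with values in `[0,∞]`. -/
def legendre (α : ℝ → ℝ) (y : ℝ) : ℝ≥0∞ := ⨆ x : ℝ, ENNReal.ofReal (x * y - α x)

/-- `ξ_α(t) = sup_{u>0} α*(t α'₊(u)) / (t α(u))`. -/
def xiAlpha (α : ℝ → ℝ) (t : ℝ) : ℝ≥0∞ :=
  ⨆ u : {u : ℝ // 0 < u}, legendre α (t * rightD α u) / ENNReal.ofReal (t * α u)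

/-- A bounded real-valued function. -/
def IsBoundedFun {Y : Type*} (f : Y → ℝ) : Prop := ∃ M, ∀ x, |f x| ≤ M

variable {X : Type*} [MetricSpace X] [MeasurableSpace X]

/-- The optimal transport cost `T_α(ν,μ)` between two measures, for the cost
function `(x,y) ↦ α(d(x,y))`. -/
def transportCost (α : ℝ → ℝ) (ν μ : Measure X) : ℝ≥0∞ :=
  sInf { c : ℝ≥0∞ | ∃ π : Measure (X × X), π.map Prod.fst = ν ∧ π.map Prod.snd = μ ∧
      c = ∫⁻ z, ENNReal.ofReal (α (dist z.1 z.2)) ∂π }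

open Classical in
/-- The relative entropy `H(ν|μ) = ∫ log (dν/dμ) dν` if `ν ≪ μ` (and `+∞` if `ν` is not
absolutely continuous with respect to `μ`, or if the integral diverges). -/
def relEnt (ν μ : Measure X) : ℝ≥0∞ :=
  if ν ≪ μ ∧ Integrable (fun x => Real.log (ν.rnDeriv μ x).toReal) ν
  then ENNReal.ofReal (∫ x, Real.log (ν.rnDeriv μ x).toReal ∂ν) else ⊤

/-- The transport-entropy inequality `T_α(C)`: for every probability measure `ν`,
`T_α(ν,μ) ≤ C H(ν|μ)`. -/
def TransportEntropy (μ : Measure X) (α : ℝ → ℝ) (C : ℝ) : Prop :=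
  ∀ ν : Measure X, IsProbabilityMeasure ν →
    transportCost α ν μ ≤ ENNReal.ofReal C * relEnt ν μ

/-- The entropy functional `Ent_μ(e^f)`. -/
def entExp (μ : Measure X) (f : X → ℝ) : ℝ :=
  ∫ x, Real.exp (f x) * Real.log (Real.exp (f x)) ∂μ
    - (∫ x, Real.exp (f x) ∂μ) * Real.log (∫ x, Real.exp (f x) ∂μ)

/-- `|∇⁺ f|(x) = limsup_{y → x} [f(y) - f(x)]₊ / d(y,x)` (equal to `0` at isolated
points by the conventions on `limsup` and `sInf` in `ℝ`). -/
def gradPlus (f : X → ℝ) (x : X) : ℝ :=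
  limsup (fun y => max (f y - f x) 0 / dist y x) (𝓝[≠] x)

/-- `|∇⁻ f|(x) = limsup_{y → x} [f(y) - f(x)]₋ / d(y,x)` (equal to `0` at isolated
points by the conventions on `limsup` and `sInf` in `ℝ`). -/
def gradMinus (f : X → ℝ) (x : X) : ℝ :=
  limsup (fun y => max (-(f y - f x)) 0 / dist y x) (𝓝[≠] x)

/-- The modified log-Sobolev inequality plus `LSI⁺_α(A)`. -/
def LSIplus (μ : Measure X) (α : ℝ → ℝ) (A : ℝ) : Prop :=
  ∀ f : X → ℝ, IsBoundedFun f → LocallyLipschitz f →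
    ENNReal.ofReal (entExp μ f) ≤
      ENNReal.ofReal A * ∫⁻ x, legendre α (gradPlus f x) * ENNReal.ofReal (Real.exp (f x)) ∂μ

/-- The modified log-Sobolev inequality minus `LSI⁻_α(A)`. -/
def LSIminus (μ : Measure X) (α : ℝ → ℝ) (A : ℝ) : Prop :=
  ∀ f : X → ℝ, IsBoundedFun f → LocallyLipschitz f →
    ENNReal.ofReal (entExp μ f) ≤
      ENNReal.ofReal A * ∫⁻ x, legendre α (gradMinus f x) * ENNReal.ofReal (Real.exp (f x)) ∂μ

/-- The inf-convolution operator `Q_α^λ f(x) = inf_y {f(y) + λ α(d(x,y))}`. -/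
def QInf (α : ℝ → ℝ) (lam : ℝ) (f : X → ℝ) (x : X) : ℝ :=
  ⨅ y : X, (f y + lam * α (dist x y))

/-- The `(τ)`-log-Sobolev inequality `(τ)-LSI_α(λ, A)`. -/
def TauLSI (μ : Measure X) (α : ℝ → ℝ) (lam A : ℝ) : Prop :=
  ∀ f : X → ℝ, IsBoundedFun f → LocallyLipschitz f →
    entExp μ f ≤ A * ∫ x, (f x - QInf α lam f x) * Real.exp (f x) ∂μ

/-- The `n`-dimensional inf-convolution operator
`Q_{α,n} f(x) = inf_y {f(y) + Σᵢ α(d(xᵢ,yᵢ))}`. -/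
def QInfN (α : ℝ → ℝ) {n : ℕ} (f : (Fin n → X) → ℝ) (x : Fin n → X) : ℝ :=
  ⨅ y : Fin n → X, (f y + ∑ i, α (dist (x i) (y i)))

/-- The `n`-dimensional sup-convolution operator
`P_{α,n} f(x) = sup_y {f(y) - Σᵢ α(d(xᵢ,yᵢ))}`. -/
def PSupN (α : ℝ → ℝ) {n : ℕ} (f : (Fin n → X) → ℝ) (x : Fin n → X) : ℝ :=
  ⨆ y : Fin n → X, (f y - ∑ i, α (dist (x i) (y i)))

end

/-- Kantorovich duality on a finite set: a bound on all dual pairs is attained by a coupling. -/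
lemma exists_finite_coupling_of_dual_le {ι : Type*} [Fintype ι] {p q : ι → ℝ}
    (hp : p ∈ stdSimplex ℝ ι) (hq : q ∈ stdSimplex ℝ ι) (c : ι → ι → ℝ) (D : ℝ)
    (hD : ∀ φ ψ : ι → ℝ, (∀ i j, φ i - ψ j ≤ c i j) → ∑ i, φ i * p i - ∑ j, ψ j * q j ≤ D) :
    ∃ w : ι → ι → ℝ, (∀ i j, 0 ≤ w i j) ∧ (∀ i, ∑ j, w i j = p i) ∧ (∀ j, ∑ i, w i j = q j) ∧
      ∑ i, ∑ j, w i j * c i j ≤ D := by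
  classical
  let T : (ι × ι → ℝ) →ₗ[ℝ] (ι → ℝ) × (ι → ℝ) × ℝ :=
    { toFun := fun w => (fun i => ∑ j, w (i, j), fun j => ∑ i, w (i, j),
        ∑ i, ∑ j, w (i, j) * c i j)
      map_add' := fun w w' => by
        ext <;> simp [Finset.sum_add_distrib, add_mul]
      map_smul' := fun r w => by
        ext <;> simp [Finset.mul_sum, mul_assoc] }
  have hTc : Continuous T := T.continuous_of_finiteDimensional
  set S : Set ((ι → ℝ) × (ι → ℝ) × ℝ) := Set.image T (stdSimplex ℝ (ι × ι))
  set B : Set ((ι → ℝ) × (ι → ℝ) × ℝ) := {p} ×ˢ {q} ×ˢ Iic D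
  by_cases hdisj : Disjoint S B
  · exfalso
    obtain ⟨f, u, v, hS, huv, hB⟩ := geometric_hahn_banach_compact_closed
      ((convex_stdSimplex ℝ (ι × ι)).linear_image T)
      ((isCompact_stdSimplex ℝ (ι × ι)).image hTc)
      ((convex_singleton p).prod ((convex_singleton q).prod (convex_Iic D)))
      (isClosed_singleton.prod (isClosed_singleton.prod isClosed_Iic)) hdisj
    let φ : ι → ℝ := fun i => f (Pi.single i 1, 0, 0)
    let ψ : ι → ℝ := fun j => f (0, Pi.single j 1, 0)
    let l : ℝ := f (0, 0, 1)
    have hsingle : ∀ i : ι, (fun j => if i = j then (1 : ℝ) else 0) = Pi.single i 1 := fun i => by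
      ext j
      simp [Pi.single_apply, eq_comm]
    have hf : ∀ x y t, f (x, y, t) = ∑ i, φ i * x i + ∑ j, ψ j * y j + l * t := by
      intro x y t
      have h1 : f (x, 0, 0) = ∑ i, φ i * x i := by
        have := (f.toLinearMap ∘ₗ LinearMap.inl ℝ (ι → ℝ) ((ι → ℝ) × ℝ)).pi_apply_eq_sum_univ x
        simp only [LinearMap.comp_apply, LinearMap.inl_apply] at this
        simp only [φ]
        refine this.trans (Finset.sum_congr rfl fun i _ => ?_)
        rw [smul_eq_mul, mul_comm, hsingle i]
        rfl
      have h2 : f (0, y, 0) = ∑ j, ψ j * y j := by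
        have := (f.toLinearMap ∘ₗ LinearMap.inr ℝ (ι → ℝ) ((ι → ℝ) × ℝ) ∘ₗ
          LinearMap.inl ℝ (ι → ℝ) ℝ).pi_apply_eq_sum_univ y
        simp only [LinearMap.comp_apply, LinearMap.inl_apply, LinearMap.inr_apply] at this
        simp only [ψ]
        refine this.trans (Finset.sum_congr rfl fun i _ => ?_)
        rw [smul_eq_mul, mul_comm, hsingle i]
        rfl
      have h3 : f (0, 0, t) = l * t := by
        have : ((0, 0, t) : (ι → ℝ) × (ι → ℝ) × ℝ) = t • (0, 0, 1) := by simp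
        rw [this, map_smul, smul_eq_mul, mul_comm]
      rw [← h1, ← h2, ← h3, ← map_add, ← map_add]
      simp
    have hcoup : f (p, q, ∑ i, ∑ j, p i * q j * c i j) < u := by
      refine hS _ ⟨fun z => p z.1 * q z.2, ⟨fun z => mul_nonneg (hp.1 _) (hq.1 _), ?_⟩, ?_⟩
      · rw [Fintype.sum_prod_type, ← Finset.sum_mul_sum, hp.2, hq.2, one_mul]
      · refine Prod.ext ?_ (Prod.ext ?_ rfl)
        · ext i
          simp [T, ← Finset.mul_sum, hq.2]
        · ext j
          simp [T, ← Finset.sum_mul, hp.2]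
    have hBs : ∀ s ≤ D, v < f (p, q, s) := fun s hs => hB _ ⟨rfl, rfl, hs⟩
    have hl : l < 0 := by
      by_contra! hl
      have h1 := hBs (min D (∑ i, ∑ j, p i * q j * c i j)) (min_le_left _ _)
      rw [hf] at h1 hcoup
      have := mul_le_mul_of_nonneg_left (min_le_right D (∑ i, ∑ j, p i * q j * c i j)) hl
      linarith
    have hdelta : ∀ i j, φ i + ψ j + l * c i j < u := by
      intro i j
      have h := hS _ ⟨Pi.single (i, j) 1, single_mem_stdSimplex ℝ (i, j), rfl⟩
      have hT : T (Pi.single (i, j) 1) = (Pi.single i 1, Pi.single j 1, c i j) := by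
        refine Prod.ext ?_ (Prod.ext ?_ ?_)
        · ext i'
          by_cases h : i' = i <;> simp [T, Pi.single_apply, h, -Finset.sum_boole]
        · ext j'
          by_cases h : j' = j <;> simp [T, Pi.single_apply, h, -Finset.sum_boole]
        · simp [T, Pi.single_apply, Prod.ext_iff, ite_and, ite_mul]
      rw [hT, hf] at h
      simpa [Pi.single_apply] using h
    have hk : 0 < -l := neg_pos.2 hl
    have key := hD (fun i => (φ i - u) / (-l)) (fun j => -ψ j / (-l)) fun i j => by
      rw [← sub_div, div_le_iff₀ hk]
      linarith [hdelta i j]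
    have h1 := hBs D le_rfl
    rw [hf] at h1
    have e1 : ∑ i, (φ i - u) / (-l) * p i = (∑ i, φ i * p i - u) / (-l) := by
      simp_rw [div_mul_eq_mul_div, ← Finset.sum_div, sub_mul, Finset.sum_sub_distrib,
        ← Finset.mul_sum, hp.2, mul_one]
    have e2 : ∑ j, -ψ j / (-l) * q j = -(∑ j, ψ j * q j) / (-l) := by
      simp_rw [div_mul_eq_mul_div, ← Finset.sum_div, neg_mul, Finset.sum_neg_distrib]
    rw [e1, e2, ← sub_div, div_le_iff₀ hk] at key
    linarith
  · obtain ⟨_, ⟨w, hw, rfl⟩, h1, h2, h3⟩ := Set.not_disjoint_iff.1 hdisj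
    exact ⟨fun i j => w (i, j), fun i j => hw.1 _, congrFun h1, congrFun h2, h3⟩

/-- A coupling of the images of `ν` and `μ` under a finite-valued map lifts to a coupling
of `ν` and `μ`. -/
lemma exists_coupling_of_matrix {Y ι : Type*} [MeasurableSpace Y] [Fintype ι] [MeasurableSpace ι]
    [MeasurableSingletonClass ι] (ν μ : Measure Y) [IsProbabilityMeasure ν]
    [IsProbabilityMeasure μ] {s : Y → ι} (hs : Measurable s) {w : ι → ι → ℝ}
    (hw : ∀ i j, 0 ≤ w i j) (hrow : ∀ i, ∑ j, w i j = ν.real (s ⁻¹' {i}))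
    (hcol : ∀ j, ∑ i, w i j = μ.real (s ⁻¹' {j})) :
    ∃ π : Measure (Y × Y), π.map Prod.fst = ν ∧ π.map Prod.snd = μ ∧
      ∀ F : ι → ι → ℝ, ∫ z, F (s z.1) (s z.2) ∂π = ∑ i, ∑ j, w i j * F i j := by
  classical
  set p : ι → ℝ := fun i => ν.real (s ⁻¹' {i})
  set q : ι → ℝ := fun j => μ.real (s ⁻¹' {j})
  have hp0 : ∀ i, 0 ≤ p i := fun i => measureReal_nonneg
  have hq0 : ∀ i, 0 ≤ q i := fun i => measureReal_nonneg
  have hwp : ∀ i j, p i = 0 → w i j = 0 := fun i j h =>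
    (Finset.sum_eq_zero_iff_of_nonneg fun j _ => hw i j).1 ((hrow i).trans h) j (Finset.mem_univ j)
  have hwq : ∀ i j, q j = 0 → w i j = 0 := fun i j h =>
    (Finset.sum_eq_zero_iff_of_nonneg fun i _ => hw i j).1 ((hcol j).trans h) i (Finset.mem_univ i)
  set g : ι → ι → ℝ := fun i j => w i j / (p i * q j)
  have hg : ∀ i j, 0 ≤ g i j := fun i j => div_nonneg (hw i j) (mul_nonneg (hp0 i) (hq0 j))
  have hgpq : ∀ i j, p i * q j * g i j = w i j := by
    intro i j
    by_cases h : p i * q j = 0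
    · rcases mul_eq_zero.1 h with h | h
      · simp [h, hwp i j h]
      · simp [h, hwq i j h]
    · simp only [g]
      rw [← mul_div_assoc, mul_div_cancel_left₀ _ h]
  have hrow1 : ∀ i, p i ≠ 0 → ∑ j, g i j * q j = 1 := by
    intro i hi
    have : p i * ∑ j, g i j * q j = p i * 1 := by
      rw [Finset.mul_sum, mul_one]
      refine Eq.trans ?_ (hrow i)
      exact Finset.sum_congr rfl fun j _ => by rw [← hgpq i j]; ring
    exact mul_left_cancel₀ hi this
  have hcol1 : ∀ j, q j ≠ 0 → ∑ i, g i j * p i = 1 := by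
    intro j hj
    have : q j * ∑ i, g i j * p i = q j * 1 := by
      rw [Finset.mul_sum, mul_one]
      refine Eq.trans ?_ (hcol j)
      exact Finset.sum_congr rfl fun i _ => by rw [← hgpq i j]; ring
    exact mul_left_cancel₀ hj this
  have hlint : ∀ (ρ : Measure Y) [IsProbabilityMeasure ρ] (h : ι → ℝ), (∀ i, 0 ≤ h i) →
      ∫⁻ y, ENNReal.ofReal (h (s y)) ∂ρ = ENNReal.ofReal (∑ i, h i * ρ.real (s ⁻¹' {i})) := by
    intro ρ _ h hh
    have h0 : Measurable fun i => ENNReal.ofReal (h i) := measurable_of_finite _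
    rw [← lintegral_map (f := fun i => ENNReal.ofReal (h i)) h0 hs, lintegral_fintype,
      ENNReal.ofReal_sum_of_nonneg fun i _ => mul_nonneg (hh i) measureReal_nonneg]
    refine Finset.sum_congr rfl fun i _ => ?_
    rw [ENNReal.ofReal_mul (hh i), Measure.map_apply hs (measurableSet_singleton i),
      ofReal_measureReal]
  have hae : ∀ (ρ : Measure Y) [IsProbabilityMeasure ρ], ∀ᵐ y ∂ρ, ρ.real (s ⁻¹' {s y}) ≠ 0 := by
    intro ρ _
    have : ∀ᵐ y ∂ρ, ∀ i, ρ.real (s ⁻¹' {i}) = 0 → s y ≠ i := by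
      rw [ae_all_iff]
      intro i
      by_cases h : ρ.real (s ⁻¹' {i}) = 0
      · have h' : ρ (s ⁻¹' {i}) = 0 := (measureReal_eq_zero_iff).1 h
        filter_upwards [measure_eq_zero_iff_ae_notMem.1 h'] with y hy _
        exact hy
      · exact Eventually.of_forall fun y hy => absurd hy h
    filter_upwards [this] with y hy h
    exact hy _ h rfl
  have hgm : Measurable fun z : Y × Y => g (s z.1) (s z.2) :=
    (measurable_of_finite fun t : ι × ι => g t.1 t.2).comp
      ((hs.comp measurable_fst).prodMk (hs.comp measurable_snd))
  have hG : Measurable fun z : Y × Y => ENNReal.ofReal (g (s z.1) (s z.2)) := hgm.ennreal_ofReal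
  refine ⟨(ν.prod μ).withDensity fun z => ENNReal.ofReal (g (s z.1) (s z.2)), ?_, ?_, ?_⟩
  · ext B hB
    rw [Measure.map_apply measurable_fst hB, withDensity_apply _ (measurable_fst hB),
      ← Set.prod_univ, ← Measure.prod_restrict, lintegral_prod _ hG.aemeasurable,
      Measure.restrict_univ]
    calc ∫⁻ x in B, ∫⁻ y, ENNReal.ofReal (g (s x) (s y)) ∂μ ∂ν = ∫⁻ x in B, 1 ∂ν := by
          refine lintegral_congr_ae (ae_restrict_of_ae ?_)
          filter_upwards [hae ν] with x hx
          rw [hlint μ (fun j => g (s x) j) (hg _), hrow1 _ hx, ENNReal.ofReal_one]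
      _ = ν B := by simp
  · ext B hB
    rw [Measure.map_apply measurable_snd hB, withDensity_apply _ (measurable_snd hB),
      ← Set.univ_prod, ← Measure.prod_restrict, lintegral_prod_symm _ hG.aemeasurable,
      Measure.restrict_univ]
    calc ∫⁻ y in B, ∫⁻ x, ENNReal.ofReal (g (s x) (s y)) ∂ν ∂μ = ∫⁻ y in B, 1 ∂μ := by
          refine lintegral_congr_ae (ae_restrict_of_ae ?_)
          filter_upwards [hae μ] with y hy
          rw [hlint ν (fun i => g i (s y)) (fun i => hg _ _), hcol1 _ hy, ENNReal.ofReal_one]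
      _ = μ B := by simp
  · intro F
    rw [integral_withDensity_eq_integral_toReal_smul hG
      (Eventually.of_forall fun _ => ENNReal.ofReal_lt_top)]
    have hss : Measurable (Prod.map s s) := hs.prodMap hs
    have : IsProbabilityMeasure (ν.map s) := Measure.isProbabilityMeasure_map hs.aemeasurable
    have : IsProbabilityMeasure (μ.map s) := Measure.isProbabilityMeasure_map hs.aemeasurable
    calc ∫ z, (ENNReal.ofReal (g (s z.1) (s z.2))).toReal • F (s z.1) (s z.2) ∂(ν.prod μ)
        = ∫ z, (fun t : ι × ι => g t.1 t.2 * F t.1 t.2) (Prod.map s s z) ∂(ν.prod μ) := by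
          refine integral_congr_ae (Eventually.of_forall fun z => ?_)
          simp [ENNReal.toReal_ofReal (hg _ _)]
      _ = ∫ t, g t.1 t.2 * F t.1 t.2 ∂((ν.map s).prod (μ.map s)) := by
          rw [Measure.map_prod_map _ _ hs hs, integral_map hss.aemeasurable
            (measurable_of_finite _).aestronglyMeasurable]
      _ = ∑ i, ∑ j, w i j * F i j := by
          rw [integral_fintype .of_finite, Fintype.sum_prod_type]
          refine Finset.sum_congr rfl fun i _ => Finset.sum_congr rfl fun j _ => ?_
          rw [← Set.singleton_prod_singleton, measureReal_prod_prod,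
            map_measureReal_apply hs (measurableSet_singleton i),
            map_measureReal_apply hs (measurableSet_singleton j), ← hgpq i j, smul_eq_mul]
          ring

/-- Kantorovich duality, up to `ε`, for a bounded cost which is Lipschitz in each variable. -/
lemma exists_coupling_integral_le_of_dual_le {X : Type*} [MetricSpace X]
    [TopologicalSpace.SeparableSpace X] [MeasurableSpace X] [BorelSpace X]
    (ν μ : Measure X) [IsProbabilityMeasure ν] [IsProbabilityMeasure μ]
    {c : X → X → ℝ} {C L : ℝ} (hcont : Continuous fun z : X × X => c z.1 z.2)
    (hc0 : ∀ x y, 0 ≤ c x y) (hcC : ∀ x y, c x y ≤ C)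
    (hc1 : ∀ x x' y, |c x y - c x' y| ≤ L * dist x x')
    (hc2 : ∀ x y y', |c x y - c x y'| ≤ L * dist y y') {D : ℝ}
    (hD : ∀ φ ψ : X → ℝ, Continuous φ → IsBoundedFun φ → Measurable ψ → IsBoundedFun ψ →
      (∀ x y, φ x - ψ y ≤ c x y) → ∫ x, φ x ∂ν - ∫ y, ψ y ∂μ ≤ D) {ε : ℝ} (hε : 0 < ε) :
    ∃ π : Measure (X × X), π.map Prod.fst = ν ∧ π.map Prod.snd = μ ∧
      ∫ z, c z.1 z.2 ∂π ≤ D + ε := by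
  classical
  have : Nonempty X := nonempty_of_isProbabilityMeasure ν
  have : SecondCountableTopology X := UniformSpace.secondCountable_of_separable X
  set e := TopologicalSpace.denseSeq X
  let err : ℕ → X → ℝ := fun N x => min C (L * dist x (SimpleFunc.nearestPt e N x))
  have hC : 0 ≤ C := (hc0 (e 0) (e 0)).trans (hcC _ _)
  have herr0 : ∀ N x, 0 ≤ err N x := fun N x =>
    le_min hC ((abs_nonneg _).trans (hc1 x _ x))
  have herrC : ∀ N x, err N x ≤ C := fun N x => min_le_left _ _
  have herrm : ∀ N, Measurable (err N) := fun N =>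
    measurable_const.min (measurable_const.mul (measurable_id.dist (SimpleFunc.measurable _)))
  have hlim : ∀ (ρ : Measure X) [IsProbabilityMeasure ρ],
      Tendsto (fun N => ∫ x, err N x ∂ρ) atTop (𝓝 0) := by
    intro ρ _
    have := tendsto_integral_of_dominated_convergence (μ := ρ) (F := err) (f := fun _ => 0)
      (fun _ => C) (fun N => (herrm N).aestronglyMeasurable) (integrable_const C)
      (fun N => Eventually.of_forall fun x => by
        rw [Real.norm_of_nonneg (herr0 N x)]
        exact herrC N x)
      (Eventually.of_forall fun x => by
        have h1 : Tendsto (fun N => SimpleFunc.nearestPt e N x) atTop (𝓝 x) :=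
          SimpleFunc.tendsto_nearestPt ((TopologicalSpace.denseRange_denseSeq X).closure_range ▸
            mem_univ x)
        have h2 : Tendsto (fun N => min C (L * dist x (SimpleFunc.nearestPt e N x))) atTop
            (𝓝 (min C (L * dist x x))) :=
          tendsto_const_nhds.min ((tendsto_const_nhds.dist h1).const_mul L)
        simpa [hC] using h2)
    simpa using this
  obtain ⟨N, hNν, hNμ⟩ := (((hlim ν).eventually_lt_const (by positivity : 0 < ε / 4)).and
    ((hlim μ).eventually_lt_const (by positivity : 0 < ε / 4))).exists
  let s : X → Fin (N + 1) := fun x =>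
    ⟨SimpleFunc.nearestPtInd e N x, Nat.lt_succ_of_le (SimpleFunc.nearestPtInd_le e N x)⟩
  let pt : Fin (N + 1) → X := fun j => e j
  have hpt : ∀ x, pt (s x) = SimpleFunc.nearestPt e N x := fun x => rfl
  have hs : Measurable s := by
    refine measurable_to_countable' fun i => ?_
    have : s ⁻¹' {i} = SimpleFunc.nearestPtInd e N ⁻¹' {(i : ℕ)} := by
      ext x
      simp [s, Fin.ext_iff]
    rw [this]
    exact SimpleFunc.measurableSet_fiber _ _
  set E : X → ℝ := err N
  have hEint : ∀ (ρ : Measure X) [IsProbabilityMeasure ρ], Integrable E ρ := fun ρ _ =>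
    Integrable.of_bound (herrm N).aestronglyMeasurable C (Eventually.of_forall fun x => by
      rw [Real.norm_of_nonneg (herr0 N x)]
      exact herrC N x)
  have hE1 : ∀ x y, |c x y - c (pt (s x)) y| ≤ E x := fun x y =>
    le_min (abs_sub_le_iff.2 ⟨by linarith [hcC x y, hc0 (pt (s x)) y],
      by linarith [hc0 x y, hcC (pt (s x)) y]⟩) (hpt x ▸ hc1 x _ y)
  have hE2 : ∀ x y, |c x y - c x (pt (s y))| ≤ E y := fun x y =>
    le_min (abs_sub_le_iff.2 ⟨by linarith [hcC x y, hc0 x (pt (s y))],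
      by linarith [hc0 x y, hcC x (pt (s y))]⟩) (hpt y ▸ hc2 x y _)
  have hsum : ∀ (ρ : Measure X) [IsProbabilityMeasure ρ] (h : Fin (N + 1) → ℝ),
      ∫ x, h (s x) ∂ρ = ∑ i, h i * ρ.real (s ⁻¹' {i}) := by
    intro ρ _ h
    have := Measure.isProbabilityMeasure_map (μ := ρ) hs.aemeasurable
    rw [← integral_map (f := h) hs.aemeasurable (measurable_of_finite h).aestronglyMeasurable,
      integral_fintype .of_finite]
    exact Finset.sum_congr rfl fun i _ => by
      rw [map_measureReal_apply hs (measurableSet_singleton i), smul_eq_mul, mul_comm]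
  have hsimplex : ∀ (ρ : Measure X) [IsProbabilityMeasure ρ],
      (fun i => ρ.real (s ⁻¹' {i})) ∈ stdSimplex ℝ (Fin (N + 1)) := by
    intro ρ _
    refine ⟨fun i => measureReal_nonneg, ?_⟩
    have := hsum ρ fun _ => 1
    simpa using this.symm
  have hint : ∀ (ρ : Measure X) [IsProbabilityMeasure ρ] (h : Fin (N + 1) → ℝ),
      Integrable (fun x => h (s x)) ρ := fun ρ _ h =>
    Integrable.of_bound ((measurable_of_finite h).comp hs).aestronglyMeasurable (∑ i, |h i|)
      (Eventually.of_forall fun x =>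
        Finset.single_le_sum (f := fun i => |h i|) (fun i _ => abs_nonneg _) (Finset.mem_univ _))
  obtain ⟨w, hw0, hwr, hwc, hwD⟩ := exists_finite_coupling_of_dual_le (hsimplex ν) (hsimplex μ)
    (fun i j => c (pt i) (pt j)) (D + ε / 2) (by
      intro f g hfg
      have hne : (Finset.univ : Finset (Fin (N + 1))).Nonempty := ⟨0, Finset.mem_univ 0⟩
      let φ : X → ℝ := fun x => Finset.univ.inf' hne fun j => g j + c x (pt j)
      have hφc : Continuous φ := Continuous.finset_inf'_apply hne fun j _ =>
        continuous_const.add (hcont.comp (continuous_id.prodMk continuous_const))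
      have hgb : ∀ j, |g j| ≤ ∑ i, |g i| := fun j =>
        Finset.single_le_sum (f := fun i => |g i|) (fun i _ => abs_nonneg _) (Finset.mem_univ _)
      have hφb : IsBoundedFun φ := by
        refine ⟨∑ i, |g i| + C, fun x => abs_le.2 ⟨?_, ?_⟩⟩
        · refine (Finset.le_inf'_iff hne _).2 fun j _ => ?_
          linarith [(abs_le.1 (hgb j)).1, hc0 x (pt j)]
        · refine (Finset.inf'_le _ (Finset.mem_univ 0)).trans ?_
          linarith [(abs_le.1 (hgb 0)).2, hcC x (pt 0)]
      have hφint : Integrable φ ν := by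
        obtain ⟨M, hM⟩ := hφb
        exact Integrable.of_bound hφc.aestronglyMeasurable M (Eventually.of_forall hM)
      have hψb : IsBoundedFun fun y => g (s y) + E y :=
        ⟨∑ i, |g i| + C, fun y => (abs_add_le _ _).trans
          (add_le_add (hgb _) ((abs_of_nonneg (herr0 N y)).le.trans (herrC N y)))⟩
      have h1 := hD φ (fun y => g (s y) + E y) hφc hφb
        (((measurable_of_finite g).comp hs).add (herrm N)) hψb fun x y => by
          have h2 : φ x ≤ g (s y) + c x (pt (s y)) := Finset.inf'_le _ (Finset.mem_univ (s y))
          linarith [(abs_le.1 (hE2 x y)).1]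
      have h2 : ∫ x, f (s x) ∂ν - ∫ x, E x ∂ν ≤ ∫ x, φ x ∂ν := by
        rw [← integral_sub (hint ν f) (hEint ν)]
        refine integral_mono ((hint ν f).sub (hEint ν)) hφint fun x => ?_
        refine (Finset.le_inf'_iff hne _).2 fun j _ => ?_
        linarith [(abs_le.1 (hE1 x (pt j))).1, hfg (s x) j]
      rw [integral_add (hint μ g) (hEint μ)] at h1
      rw [← hsum ν f, ← hsum μ g]
      linarith)
  obtain ⟨π, hπ1, hπ2, hπ⟩ := exists_coupling_of_matrix ν μ hs hw0 hwr hwc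
  have hπp : IsProbabilityMeasure π := by
    constructor
    have := congrArg (fun ρ => ρ univ) hπ1
    simpa [Measure.map_apply measurable_fst MeasurableSet.univ] using this
  refine ⟨π, hπ1, hπ2, ?_⟩
  have hcint : Integrable (fun z : X × X => c z.1 z.2) π :=
    Integrable.of_bound hcont.aestronglyMeasurable C (Eventually.of_forall fun z => by
      rw [Real.norm_of_nonneg (hc0 _ _)]
      exact hcC _ _)
  have hcsint : Integrable (fun z : X × X => c (pt (s z.1)) (pt (s z.2))) π :=
    Integrable.of_bound ((measurable_of_finite fun t : Fin (N + 1) × Fin (N + 1) =>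
      c (pt t.1) (pt t.2)).comp ((hs.comp measurable_fst).prodMk
        (hs.comp measurable_snd))).aestronglyMeasurable C (Eventually.of_forall fun z => by
      rw [Real.norm_of_nonneg (hc0 _ _)]
      exact hcC _ _)
  have hE1int : Integrable (fun z : X × X => E z.1) π :=
    Integrable.comp_measurable (g := E) (f := Prod.fst) (hπ1 ▸ hEint ν) measurable_fst
  have hE2int : Integrable (fun z : X × X => E z.2) π :=
    Integrable.comp_measurable (g := E) (f := Prod.snd) (hπ2 ▸ hEint μ) measurable_snd
  have hE1eq : ∫ z, E z.1 ∂π = ∫ x, E x ∂ν := by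
    rw [← hπ1, integral_map measurable_fst.aemeasurable (herrm N).aestronglyMeasurable]
  have hE2eq : ∫ z, E z.2 ∂π = ∫ x, E x ∂μ := by
    rw [← hπ2, integral_map measurable_snd.aemeasurable (herrm N).aestronglyMeasurable]
  calc ∫ z, c z.1 z.2 ∂π ≤ ∫ z, (c (pt (s z.1)) (pt (s z.2)) + E z.1 + E z.2) ∂π := by
        refine integral_mono hcint ((hcsint.add hE1int).add hE2int) fun z => ?_
        simp only
        linarith [(abs_le.1 (hE1 z.1 z.2)).2, (abs_le.1 (hE2 (pt (s z.1)) z.2)).2]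
    _ = ∑ i, ∑ j, w i j * c (pt i) (pt j) + ∫ x, E x ∂ν + ∫ x, E x ∂μ := by
        rw [integral_add (by exact hcsint.add hE1int) hE2int, integral_add hcsint hE1int, hE1eq, hE2eq,
          hπ fun i j => c (pt i) (pt j)]
    _ ≤ D + ε := by linarith

lemma IsYoung.continuous {α : ℝ → ℝ} (hα : IsYoung α) : Continuous α :=
  hα.convex.locallyLipschitz.continuous

lemma IsYoung.abs_min_sub_min_le {α : ℝ → ℝ} (hα : IsYoung α) {k s t : ℝ} (hk : 0 ≤ k)
    (hs : 0 ≤ s) (ht : 0 ≤ t) : |α (min s k) - α (min t k)| ≤ α (k + 1) * |s - t| := by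
  have key : ∀ u v : ℝ, 0 ≤ u → u < v → v ≤ k → |α v - α u| ≤ α (k + 1) * |v - u| := by
    intro u v hu huv hvk
    have h1 := hα.convex.slope_mono_adjacent (mem_univ u) (mem_univ (k + 1)) huv
      (by linarith : v < k + 1)
    have h2 : (α (k + 1) - α v) / (k + 1 - v) ≤ α (k + 1) := by
      rw [div_le_iff₀ (by linarith)]
      nlinarith [hα.nonneg v, hα.nonneg (k + 1)]
    have h3 := hα.mono.monotoneOn (mem_Ici.2 hu) (mem_Ici.2 (hu.trans huv.le)) huv.le
    rw [abs_of_nonneg (sub_nonneg.2 h3), abs_of_pos (sub_pos.2 huv),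
      ← div_le_iff₀ (sub_pos.2 huv)]
    exact h1.trans h2
  have hmin : |α (min s k) - α (min t k)| ≤ α (k + 1) * |min s k - min t k| := by
    rcases lt_trichotomy (min s k) (min t k) with h | h | h
    · rw [abs_sub_comm, abs_sub_comm (min s k)]
      exact key _ _ (le_min hs hk) h (min_le_right _ _)
    · simp [h]
    · exact key _ _ (le_min ht hk) h (min_le_right _ _)
  refine hmin.trans (mul_le_mul_of_nonneg_left ?_ (hα.nonneg _))
  simpa using abs_min_sub_min_le_max s k t k

/-- Kantorovich duality for the cost `α (d x y)` on a Polish space. -/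
lemma transportCost_le_of_dual_le {X : Type*} [MetricSpace X] [CompleteSpace X]
    [TopologicalSpace.SeparableSpace X] [MeasurableSpace X] [BorelSpace X]
    {α : ℝ → ℝ} (hα : IsYoung α) (ν μ : Measure X) [IsProbabilityMeasure ν]
    [IsProbabilityMeasure μ] {D : ℝ}
    (hD : ∀ φ ψ : X → ℝ, Continuous φ → IsBoundedFun φ → Measurable ψ → IsBoundedFun ψ →
      (∀ x y, φ x - ψ y ≤ α (dist x y)) → ∫ x, φ x ∂ν - ∫ y, ψ y ∂μ ≤ D) :
    transportCost α ν μ ≤ ENNReal.ofReal D := by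
  have : SecondCountableTopology X := UniformSpace.secondCountable_of_separable X
  let c : ℕ → X → X → ℝ := fun k x y => α (min (dist x y) k)
  have hcont : ∀ k, Continuous fun z : X × X => c k z.1 z.2 := fun k =>
    hα.continuous.comp (continuous_dist.min continuous_const)
  have hc0 : ∀ k x y, 0 ≤ c k x y := fun k x y => hα.nonneg _
  have hmem : ∀ (k : ℕ) (x y : X), (0 : ℝ) ≤ min (dist x y) k := fun k x y =>
    le_min dist_nonneg k.cast_nonneg
  have hcC : ∀ k x y, c k x y ≤ α k := fun k x y =>
    hα.mono.monotoneOn (hmem k x y) (mem_Ici.2 k.cast_nonneg) (min_le_right _ _)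
  have hcα : ∀ k x y, c k x y ≤ α (dist x y) := fun k x y =>
    hα.mono.monotoneOn (hmem k x y) (mem_Ici.2 dist_nonneg) (min_le_left _ _)
  have hcmono : ∀ x y, Monotone fun k => c k x y := fun x y k l hkl =>
    hα.mono.monotoneOn (hmem k x y) (hmem l x y) (min_le_min_left _ (Nat.cast_le.2 hkl))
  have hex : ∀ k : ℕ, ∃ π : ProbabilityMeasure (X × X), (π : Measure (X × X)).map Prod.fst = ν ∧
      (π : Measure (X × X)).map Prod.snd = μ ∧
      ∫ z, c k z.1 z.2 ∂(π : Measure (X × X)) ≤ D + 1 / ((k : ℝ) + 1) := by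
    intro k
    obtain ⟨π, h1, h2, h3⟩ := exists_coupling_integral_le_of_dual_le ν μ (hcont k) (hc0 k) (hcC k)
      (L := α (k + 1))
      (fun x x' y => (hα.abs_min_sub_min_le k.cast_nonneg dist_nonneg dist_nonneg).trans
        (mul_le_mul_of_nonneg_left (abs_dist_sub_le x x' y) (hα.nonneg _)))
      (fun x y y' => (hα.abs_min_sub_min_le k.cast_nonneg dist_nonneg dist_nonneg).trans
        (mul_le_mul_of_nonneg_left (by
          rw [dist_comm x y, dist_comm x y']
          exact abs_dist_sub_le y y' x) (hα.nonneg _)))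
      (fun φ ψ hφ hφb hψ hψb h => hD φ ψ hφ hφb hψ hψb fun x y => (h x y).trans (hcα k x y))
      (ε := 1 / ((k : ℝ) + 1)) (by positivity)
    have hπp : IsProbabilityMeasure π := by
      constructor
      have := congrArg (fun ρ => ρ univ) h1
      simpa [Measure.map_apply measurable_fst MeasurableSet.univ] using this
    exact ⟨⟨π, hπp⟩, h1, h2, h3⟩
  choose P hP1 hP2 hP3 using hex
  let S : Set (ProbabilityMeasure (X × X)) := {π | (π : Measure (X × X)).map Prod.fst = ν ∧
      (π : Measure (X × X)).map Prod.snd = μ}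
  have hS : IsCompact (closure S) := by
    refine isCompact_closure_of_isTightMeasureSet ?_
    rw [isTightMeasureSet_iff_exists_isCompact_measure_compl_le]
    intro ε hε
    obtain ⟨K, hK, hKε⟩ := isTightMeasureSet_iff_exists_isCompact_measure_compl_le.1
      (isTightMeasureSet_singleton (μ := ν)) (ε / 2) (ENNReal.half_pos hε.ne')
    obtain ⟨K', hK', hKε'⟩ := isTightMeasureSet_iff_exists_isCompact_measure_compl_le.1
      (isTightMeasureSet_singleton (μ := μ)) (ε / 2) (ENNReal.half_pos hε.ne')
    refine ⟨K ×ˢ K', hK.prod hK', ?_⟩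
    rintro _ ⟨π, ⟨h1, h2⟩, rfl⟩
    have hsub : (K ×ˢ K')ᶜ ⊆ Prod.fst ⁻¹' Kᶜ ∪ Prod.snd ⁻¹' K'ᶜ := by
      intro z hz
      by_contra h
      simp only [mem_union, mem_preimage, mem_compl_iff, not_or, not_not] at h
      exact hz ⟨h.1, h.2⟩
    calc (π : Measure (X × X)) (K ×ˢ K')ᶜ
        ≤ (π : Measure (X × X)) (Prod.fst ⁻¹' Kᶜ) + (π : Measure (X × X)) (Prod.snd ⁻¹' K'ᶜ) :=
          (measure_mono hsub).trans (measure_union_le _ _)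
      _ = ν Kᶜ + μ K'ᶜ := by
          rw [← Measure.map_apply measurable_fst hK.measurableSet.compl,
            ← Measure.map_apply measurable_snd hK'.measurableSet.compl, h1, h2]
      _ ≤ ε / 2 + ε / 2 := add_le_add (hKε _ rfl) (hKε' _ rfl)
      _ = ε := ENNReal.add_halves ε
  let U : Ultrafilter ℕ := hyperfilter ℕ
  have hUtop : (U : Filter ℕ) ≤ atTop := by
    rw [← Nat.cofinite_eq_atTop]
    exact hyperfilter_le_cofinite
  obtain ⟨Q, -, hQ⟩ := isCompact_iff_ultrafilter_le_nhds'.1 hS (U.map P)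
    (Filter.mem_map.2 (Eventually.of_forall fun k => subset_closure ⟨hP1 k, hP2 k⟩))
  have hPQ : Tendsto P U (𝓝 Q) := hQ
  have hmarg : ∀ (f : X × X → X) (hf : Continuous f) (ρ : ProbabilityMeasure X),
      (∀ k, (P k : Measure (X × X)).map f = ρ) → (Q : Measure (X × X)).map f = ρ := by
    intro f hf ρ h
    have h1 := ((ProbabilityMeasure.continuous_map hf).tendsto Q).comp hPQ
    have h2 : Q.map hf.aemeasurable = ρ := by
      refine tendsto_nhds_unique h1 (tendsto_const_nhds.congr fun k => ?_)
      exact Subtype.ext (h k).symm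
    exact congrArg Subtype.val h2
  have hQc : ∀ m, ∫ z, c m z.1 z.2 ∂(Q : Measure (X × X)) ≤ D := by
    intro m
    let F : BoundedContinuousFunction (X × X) ℝ := BoundedContinuousFunction.ofNormedAddCommGroup
      (fun z => c m z.1 z.2) (hcont m) (α m) fun z => by
        rw [Real.norm_of_nonneg (hc0 _ _ _)]
        exact hcC _ _ _
    have h1 := ProbabilityMeasure.tendsto_iff_forall_integral_tendsto.1 hPQ F
    have h2 : Tendsto (fun k : ℕ => D + 1 / ((k : ℝ) + 1)) U (𝓝 (D + 0)) :=
      (tendsto_const_nhds.add tendsto_one_div_add_atTop_nhds_zero_nat).mono_left hUtop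
    rw [add_zero] at h2
    refine le_of_tendsto_of_tendsto h1 h2 (((eventually_ge_atTop m).filter_mono hUtop).mono ?_)
    intro k hk
    have hi : ∀ l, Integrable (fun z : X × X => c l z.1 z.2) (P k : Measure (X × X)) := fun l =>
      Integrable.of_bound (hcont l).aestronglyMeasurable (α l) (Eventually.of_forall fun z => by
        rw [Real.norm_of_nonneg (hc0 _ _ _)]
        exact hcC _ _ _)
    exact (integral_mono (hi m) (hi k) fun z => hcmono z.1 z.2 hk).trans (hP3 k)
  have hlim : Tendsto (fun m => ∫⁻ z, ENNReal.ofReal (c m z.1 z.2) ∂(Q : Measure (X × X))) atTop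
      (𝓝 (∫⁻ z, ENNReal.ofReal (α (dist z.1 z.2)) ∂(Q : Measure (X × X)))) := by
    refine lintegral_tendsto_of_tendsto_of_monotone
      (fun m => (hcont m).measurable.ennreal_ofReal.aemeasurable)
      (Eventually.of_forall fun z m l hml => ENNReal.ofReal_le_ofReal (hcmono z.1 z.2 hml))
      (Eventually.of_forall fun z => ?_)
    obtain ⟨k, hk⟩ := exists_nat_ge (dist z.1 z.2)
    refine tendsto_const_nhds.congr' ((eventually_ge_atTop k).mono fun m hm => ?_)
    simp only [c]
    rw [min_eq_left (hk.trans (Nat.cast_le.2 hm))]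
  have hT : transportCost α ν μ ≤
      ∫⁻ z, ENNReal.ofReal (α (dist z.1 z.2)) ∂(Q : Measure (X × X)) :=
    sInf_le ⟨(Q : Measure (X × X)), hmarg _ continuous_fst ⟨ν, inferInstance⟩ hP1,
      hmarg _ continuous_snd ⟨μ, inferInstance⟩ hP2, rfl⟩
  refine hT.trans (le_of_tendsto' hlim fun m => ?_)
  have hi : Integrable (fun z : X × X => c m z.1 z.2) (Q : Measure (X × X)) :=
    Integrable.of_bound (hcont m).aestronglyMeasurable (α m) (Eventually.of_forall fun z => by
      rw [Real.norm_of_nonneg (hc0 _ _ _)]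
      exact hcC _ _ _)
  rw [← ofReal_integral_eq_lintegral_ofReal hi (Eventually.of_forall fun z => hc0 _ _ _)]
  exact ENNReal.ofReal_le_ofReal (hQc m)

lemma bddAbove_range_sub_of_nonneg {Y : Type*} {c : Y → Y → ℝ} (hc : ∀ x y, 0 ≤ c x y)
    {f : Y → ℝ} {M : ℝ} (hf : ∀ y, f y ≤ M) (x : Y) :
    BddAbove (range fun y => f y - c x y) :=
  ⟨M, by rintro _ ⟨y, rfl⟩; linarith [hf y, hc x y]⟩

lemma le_iSup_sub_of_nonneg {Y : Type*} {c : Y → Y → ℝ} (hc : ∀ x y, 0 ≤ c x y)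
    (hc0 : ∀ x, c x x = 0) {f : Y → ℝ} {M : ℝ} (hf : ∀ y, f y ≤ M) (x : Y) :
    f x ≤ ⨆ y, (f y - c x y) := by
  simpa [hc0] using le_ciSup (bddAbove_range_sub_of_nonneg hc hf x) x

lemma iSup_sub_le_of_nonneg {Y : Type*} {c : Y → Y → ℝ} (hc : ∀ x y, 0 ≤ c x y)
    {f : Y → ℝ} {M : ℝ} (hf : ∀ y, f y ≤ M) (x : Y) : ⨆ y, (f y - c x y) ≤ M :=
  have : Nonempty Y := ⟨x⟩
  ciSup_le fun y => by linarith [hf y, hc x y]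

lemma measurable_iSup_sub_of_nonneg {Y : Type*} [TopologicalSpace Y] [MeasurableSpace Y]
    [BorelSpace Y] {c : Y → Y → ℝ} (hc : ∀ x y, 0 ≤ c x y)
    (hcc : ∀ y, Continuous fun x => c x y) {f : Y → ℝ} {M : ℝ} (hf : ∀ y, f y ≤ M) :
    Measurable fun x => ⨆ y, (f y - c x y) :=
  (lowerSemicontinuous_ciSup (bddAbove_range_sub_of_nonneg hc hf) fun y =>
    (continuous_const.sub (hcc y)).lowerSemicontinuous).measurable

/-- The positive part of a centered sum of `n` bounded i.i.d. variables has mean `o(n)`. -/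
lemma integral_max_sum_sub_le {X : Type*} [MeasurableSpace X] (μ : Measure X)
    [IsProbabilityMeasure μ] {g : X → ℝ} (hg : Measurable g) {M : ℝ} (hM : ∀ x, |g x| ≤ M)
    {n : ℕ} (hn : 0 < n) {δ : ℝ} (hδ : 0 < δ) :
    ∫ x, max (∑ i, g (x i) - n * ∫ z, g z ∂μ) 0 ∂(Measure.pi fun _ : Fin n => μ) ≤
      M ^ 2 / (4 * δ) + δ * n := by
  set m := ∫ z, g z ∂μ
  set ν := Measure.pi fun _ : Fin n => μ
  have hn' : (0 : ℝ) < n := Nat.cast_pos.2 hn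
  have hL : MemLp g 2 μ :=
    MemLp.of_bound hg.aestronglyMeasurable M (Eventually.of_forall hM)
  have hgi : Integrable g μ := hL.integrable (by norm_num)
  have hmeas : Measurable fun x : Fin n → X => ∑ i, g (x i) :=
    Finset.measurable_sum _ fun i _ => hg.comp (measurable_pi_apply i)
  have hb : ∀ x : Fin n → X, |∑ i, g (x i)| ≤ n * M := fun x =>
    (Finset.abs_sum_le_sum_abs _ _).trans
      ((Finset.sum_le_sum fun i _ => hM (x i)).trans (by simp))
  have hLs : MemLp (fun x : Fin n → X => ∑ i, g (x i) - n * m) 2 ν :=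
    (MemLp.of_bound hmeas.aestronglyMeasurable (n * M) (Eventually.of_forall hb)).sub
      (memLp_const _)
  have hmean : ∫ x, ∑ i, g (x i) ∂ν = n * m := by
    rw [integral_finsetSum _ fun i _ => integrable_comp_eval (i := i) hgi]
    rw [Finset.sum_congr rfl fun i _ =>
      integral_comp_eval (μ := fun _ : Fin n => μ) (i := i) hg.aestronglyMeasurable]
    simp [m]
  have hvar : ∫ x, (∑ i, g (x i) - n * m) ^ 2 ∂ν ≤ n * M ^ 2 := by
    have h1 := ProbabilityTheory.variance_sum_pi (μ := fun _ : Fin n => μ)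
      (X := fun _ : Fin n => g) fun _ => hL
    have h2 : (∑ i : Fin n, fun x : Fin n → X => g (x i)) = fun x => ∑ i, g (x i) := by
      ext x; simp
    have h3 := ProbabilityTheory.variance_le_sq_of_bounded (μ := μ) (a := -M) (b := M)
      (Eventually.of_forall fun x => abs_le.1 (hM x)) hg.aemeasurable
    rw [h2, ProbabilityTheory.variance_eq_integral hmeas.aemeasurable] at h1
    change ∫ x, (∑ i, g (x i) - ∫ x, ∑ i, g (x i) ∂ν) ^ 2 ∂ν = _ at h1
    rw [hmean] at h1
    rw [h1, Finset.sum_const, Finset.card_univ, Fintype.card_fin, nsmul_eq_mul]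
    refine mul_le_mul_of_nonneg_left (h3.trans_eq (by ring)) hn'.le
  calc ∫ x, max (∑ i, g (x i) - n * m) 0 ∂ν
      ≤ ∫ x, ((∑ i, g (x i) - n * m) ^ 2 * (4 * δ * n)⁻¹ + δ * n) ∂ν := by
        refine integral_mono_of_nonneg (Eventually.of_forall fun x => le_max_right _ _)
          ((hLs.integrable_sq.mul_const _).add (integrable_const _))
          (Eventually.of_forall fun x => max_le ?_ (by positivity))
        set s := ∑ i, g (x i) - n * m
        have : s ^ 2 * (4 * δ * n)⁻¹ + δ * n - s = (s - 2 * δ * n) ^ 2 * (4 * δ * n)⁻¹ := by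
          field_simp; ring
        have h0 : 0 ≤ (s - 2 * δ * n) ^ 2 * (4 * δ * n)⁻¹ := by positivity
        linarith
    _ = (∫ x, (∑ i, g (x i) - n * m) ^ 2 ∂ν) * (4 * δ * n)⁻¹ + δ * n := by
        rw [integral_add (hLs.integrable_sq.mul_const _) (integrable_const _), integral_mul_const]
        simp
    _ ≤ n * M ^ 2 * (4 * δ * n)⁻¹ + δ * n := by gcongr
    _ = M ^ 2 / (4 * δ) + δ * n := by field_simp

/-- The entropy inequality (one half of the Gibbs variational principle). -/
lemma integral_le_integral_log_rnDeriv {Ω : Type*} [MeasurableSpace Ω] {ν μ : Measure Ω}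
    [IsProbabilityMeasure ν] [IsProbabilityMeasure μ] (hac : ν ≪ μ)
    (hint : Integrable (fun x => Real.log (ν.rnDeriv μ x).toReal) ν) {h : Ω → ℝ}
    (hν : Integrable h ν) (hμ : Integrable (fun x => Real.exp (h x)) μ)
    (hexp : ∫ x, Real.exp (h x) ∂μ ≤ 1) :
    ∫ x, h x ∂ν ≤ ∫ x, Real.log (ν.rnDeriv μ x).toReal ∂ν := by
  set ρ := fun x => (ν.rnDeriv μ x).toReal with hρ
  have hρm : Measurable ρ := (Measure.measurable_rnDeriv ν μ).ennreal_toReal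
  have hle : ∀ x, ρ x * (Real.exp (h x) / ρ x) ≤ Real.exp (h x) := by
    intro x
    rcases eq_or_ne (ρ x) 0 with h0 | h0
    · simp [h0, (Real.exp_pos _).le]
    · rw [mul_div_cancel₀ _ h0]
  have hρ0 : ∀ x, 0 ≤ ρ x := fun x => ENNReal.toReal_nonneg
  have hnn : ∀ x, 0 ≤ ρ x * (Real.exp (h x) / ρ x) := fun x =>
    mul_nonneg (hρ0 x) (div_nonneg (Real.exp_pos _).le (hρ0 x))
  have hi : Integrable (fun x => ρ x * (Real.exp (h x) / ρ x)) μ :=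
    hμ.mono' (hρm.aestronglyMeasurable.mul
      (hμ.aestronglyMeasurable.aemeasurable.div hρm.aemeasurable).aestronglyMeasurable)
      (Eventually.of_forall fun x => by rw [Real.norm_of_nonneg (hnn x)]; exact hle x)
  have hi' : Integrable (fun x => Real.exp (h x) / ρ x) ν :=
    (integrable_rnDeriv_smul_iff hac).1 hi
  have hone : ∫ x, Real.exp (h x) / ρ x ∂ν ≤ 1 := by
    rw [← integral_rnDeriv_smul hac]
    exact (integral_mono hi hμ hle).trans hexp
  have hmain : ∫ x, (h x - Real.log (ρ x)) ∂ν ≤ ∫ x, (Real.exp (h x) / ρ x - 1) ∂ν := by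
    refine integral_mono_ae (hν.sub hint) (hi'.sub (integrable_const _)) ?_
    filter_upwards [Measure.rnDeriv_pos hac, hac.ae_le (Measure.rnDeriv_ne_top ν μ)]
      with x h0 htop
    have hpos : 0 < ρ x := ENNReal.toReal_pos h0.ne' htop
    have := Real.add_one_le_exp (h x - Real.log (ρ x))
    rw [Real.exp_sub, Real.exp_log hpos] at this
    linarith
  rw [integral_sub hν hint, integral_sub hi' (integrable_const _)] at hmain
  simp only [integral_const, probReal_univ, smul_eq_mul, mul_one] at hmain
  linarith

/-- Discretization of the exponential of a function `F` with values in `[0, N s]` by the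
truncations `min F (k s)`. -/
lemma exp_mul_le_sum_exp_truncation {τ c s F : ℝ} (hτ : 0 < τ) (hc1 : c < 1) (hs : 0 < s)
    (hF : 0 ≤ F) {N : ℕ} (hFN : F ≤ N * s) {p : ℕ → ℝ} (hp : ∀ k : ℕ, min F (k * s) ≤ p k) :
    Real.exp (τ * (1 - c) * F) ≤
      ∑ k ∈ Finset.range (N + 1),
        Real.exp (τ * (1 - c) * s - τ * c * (k * s)) * Real.exp (τ * p k) := by
  have hκ : 0 < τ * (1 - c) := mul_pos hτ (by linarith)
  have hk1 : (⌊F / s⌋₊ : ℝ) * s ≤ F :=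
    (le_div_iff₀ hs).1 (Nat.floor_le (div_nonneg hF hs.le))
  have hk2 : F ≤ (⌊F / s⌋₊ + 1) * s := ((div_lt_iff₀ hs).1 (Nat.lt_floor_add_one _)).le
  have hkN : ⌊F / s⌋₊ < N + 1 :=
    Nat.lt_succ_of_le (Nat.floor_le_of_le ((div_le_iff₀ hs).2 hFN))
  set k := ⌊F / s⌋₊
  refine le_trans ?_ (Finset.single_le_sum (fun j _ => by positivity) (Finset.mem_range.2 hkN))
  rw [← Real.exp_add, Real.exp_le_exp]
  have hpk : (k : ℝ) * s ≤ p k := by simpa [min_eq_right hk1] using hp k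
  nlinarith [mul_le_mul_of_nonneg_left hk2 hκ.le, mul_le_mul_of_nonneg_left hpk hτ.le]

lemma pow_integral_exp_le_of_sup_convolution_bound
    {X : Type*} [MetricSpace X] [TopologicalSpace.SeparableSpace X]
    [MeasurableSpace X] [BorelSpace X] {α : ℝ → ℝ} (hα : IsYoung α)
    (μ : Measure X) [IsProbabilityMeasure μ]
    {τ a b c : ℝ} (hτ : 0 < τ) (ha : 0 < a) (hb : 0 < b) (hc0 : 0 ≤ c) (hc1 : c < 1)
    {n : ℕ} (hn : 0 < n)
    (H : ∀ f : (Fin n → X) → ℝ, Continuous f → IsBoundedFun f → (∀ x, 0 ≤ f x) →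
        ∫ x, Real.exp (τ * PSupN α f x) ∂(Measure.pi fun _ : Fin n => μ) ≤
          a * Real.exp (b * ∫ x, PSupN α f x ∂(Measure.pi fun _ : Fin n => μ)) *
            Real.exp (τ * c * ⨆ x, f x))
    {φ : X → ℝ} (hφ : Continuous φ) {M : ℝ} (hM : ∀ x, |φ x| ≤ M) {δ : ℝ} (hδ : 0 < δ)
    {N : ℕ} (hN : 2 * M ≤ N * δ) :
    (∫ x, Real.exp (τ * (1 - c) * (φ x - ∫ z, ⨆ y, (φ y - α (dist z y)) ∂μ)) ∂μ) ^ n ≤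
      (N + 1) * (a * Real.exp (τ * (1 - c) * (δ * n) + b * (M ^ 2 / (4 * δ) + δ * n))) := by
  have : SecondCountableTopology X := UniformSpace.secondCountable_of_separable X
  have hX : Nonempty X := nonempty_of_isProbabilityMeasure μ
  have hn' : (0 : ℝ) < n := Nat.cast_pos.2 hn
  have hκ : 0 < τ * (1 - c) := mul_pos hτ (by linarith)
  have hd0 : ∀ x y : X, 0 ≤ α (dist x y) := fun x y => hα.nonneg _
  have hd : ∀ x : X, α (dist x x) = 0 := fun x => by rw [dist_self, hα.zero]
  have hdc : ∀ y : X, Continuous fun x => α (dist x y) := fun y =>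
    hα.continuous.comp (continuous_id.dist continuous_const)
  have hφM : ∀ x, φ x ≤ M := fun x => (abs_le.1 (hM x)).2
  set g : X → ℝ := fun z => ⨆ y, (φ y - α (dist z y)) with hg
  have hgm : Measurable g := measurable_iSup_sub_of_nonneg hd0 hdc hφM
  have hφg : ∀ x, φ x ≤ g x := le_iSup_sub_of_nonneg hd0 hd hφM
  have hgle : ∀ x y, φ y - α (dist x y) ≤ g x := fun x y =>
    le_ciSup (bddAbove_range_sub_of_nonneg hd0 hφM x) y
  have hgM : ∀ x, |g x| ≤ M := fun x =>
    abs_le.2 ⟨(abs_le.1 (hM x)).1.trans (hφg x), iSup_sub_le_of_nonneg hd0 hφM x⟩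
  have hgi : Integrable g μ :=
    Integrable.of_bound hgm.aestronglyMeasurable M (Eventually.of_forall hgM)
  set m := ∫ z, g z ∂μ with hm
  have hmM : -M ≤ m := by
    have := integral_mono (integrable_const (-M)) hgi fun x => (abs_le.1 (hgM x)).1
    simpa using this
  set ν := Measure.pi fun _ : Fin n => μ
  set s : ℝ := δ * n
  have hs : 0 < s := mul_pos hδ hn'
  set F : (Fin n → X) → ℝ := fun x => max (∑ i, φ (x i) - n * m) 0 with hF
  set G : (Fin n → X) → ℝ := fun x => max (∑ i, g (x i) - n * m) 0 with hG
  have hF0 : ∀ x, 0 ≤ F x := fun x => le_max_right _ _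
  have hFc : Continuous F :=
    ((continuous_finsetSum _ fun i _ => hφ.comp (continuous_apply i)).sub
      continuous_const).max continuous_const
  have hM0 : 0 ≤ M := (abs_nonneg _).trans (hM hX.some)
  have hsum : ∀ u : X → ℝ, (∀ x, |u x| ≤ M) → ∀ x : Fin n → X,
      max (∑ i, u (x i) - n * m) 0 ≤ 2 * M * n := by
    intro u hu x
    refine max_le ?_ (by positivity)
    have h1 : ∑ i, u (x i) ≤ n * M := by
      simpa using Finset.sum_le_sum (s := Finset.univ) fun i _ => (abs_le.1 (hu (x i))).2
    nlinarith
  have hFN : ∀ x, F x ≤ N * s := fun x => (hsum φ hM x).trans <| by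
    have := mul_le_mul_of_nonneg_right hN hn'.le
    simp only [s]
    linarith
  have hC0 : ∀ x y : Fin n → X, 0 ≤ ∑ i, α (dist (x i) (y i)) := fun x y =>
    Finset.sum_nonneg fun i _ => hα.nonneg _
  have hCd : ∀ x : Fin n → X, ∑ i, α (dist (x i) (x i)) = 0 := fun x => by simp [hα.zero]
  have hCc : ∀ y : Fin n → X, Continuous fun x : Fin n → X => ∑ i, α (dist (x i) (y i)) :=
    fun y => continuous_finsetSum _ fun i _ => (hdc (y i)).comp (continuous_apply i)
  set f : ℕ → (Fin n → X) → ℝ := fun k x => min (F x) (k * s) with hf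
  have hf0 : ∀ k x, 0 ≤ f k x := fun k x => le_min (hF0 x) (by positivity)
  have hfk : ∀ k x, f k x ≤ k * s := fun k x => min_le_right _ _
  have hfP : ∀ k x, f k x ≤ PSupN α (f k) x := fun k =>
    le_iSup_sub_of_nonneg hC0 hCd (hfk k)
  have hPk : ∀ k x, PSupN α (f k) x ≤ k * s := fun k => iSup_sub_le_of_nonneg hC0 (hfk k)
  have hPm : ∀ k, Measurable (PSupN α (f k)) := fun k =>
    measurable_iSup_sub_of_nonneg hC0 hCc (hfk k)
  have hPG : ∀ k x, PSupN α (f k) x ≤ G x := by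
    intro k x
    have : Nonempty (Fin n → X) := ⟨x⟩
    refine ciSup_le fun y => ?_
    have h1 : ∑ i, φ (y i) - ∑ i, α (dist (x i) (y i)) ≤ ∑ i, g (x i) := by
      rw [← Finset.sum_sub_distrib]
      exact Finset.sum_le_sum fun i _ => hgle _ _
    have h2 : f k y ≤ F y := min_le_left _ _
    have h3 := hC0 x y
    rcases max_choice (∑ i, φ (y i) - n * m) 0 with h | h
    · have h4 : F y = ∑ i, φ (y i) - n * m := h
      exact le_max_of_le_left (by linarith)
    · have h4 : F y = 0 := h
      exact le_max_of_le_right (by linarith)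
  have hPi : ∀ k, Integrable (PSupN α (f k)) ν := fun k =>
    Integrable.of_bound (hPm k).aestronglyMeasurable (k * s) (Eventually.of_forall fun x => by
      rw [Real.norm_of_nonneg ((hf0 k x).trans (hfP k x))]
      exact hPk k x)
  have hEi : ∀ k, Integrable (fun x => Real.exp (τ * PSupN α (f k) x)) ν := fun k =>
    Integrable.of_bound ((hPm k).const_mul τ).exp.aestronglyMeasurable (Real.exp (τ * (k * s)))
      (Eventually.of_forall fun x => by
        rw [Real.norm_of_nonneg (Real.exp_pos _).le]
        exact Real.exp_le_exp.2 (mul_le_mul_of_nonneg_left (hPk k x) hτ.le))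
  have hGi : Integrable G ν :=
    Integrable.of_bound (((Finset.measurable_sum _ fun i _ =>
      hgm.comp (measurable_pi_apply i)).sub_const _).max measurable_const).aestronglyMeasurable
      (2 * M * n) (Eventually.of_forall fun x => by
        rw [Real.norm_of_nonneg (le_max_right _ _)]
        exact hsum g hgM x)
  have hGle : ∫ x, G x ∂ν ≤ M ^ 2 / (4 * δ) + δ * n := integral_max_sum_sub_le μ hgm hgM hn hδ
  have hbound : ∀ k : ℕ, ∫ x, Real.exp (τ * PSupN α (f k) x) ∂ν ≤
      a * Real.exp (b * (M ^ 2 / (4 * δ) + δ * n)) * Real.exp (τ * c * (k * s)) := by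
    intro k
    have : Nonempty (Fin n → X) := ⟨fun _ => hX.some⟩
    refine (H (f k) (hFc.min continuous_const) ⟨k * s, fun x => by
      rw [abs_of_nonneg (hf0 k x)]; exact hfk k x⟩ (hf0 k)).trans ?_
    have h1 : ∫ x, PSupN α (f k) x ∂ν ≤ M ^ 2 / (4 * δ) + δ * n :=
      (integral_mono (hPi k) hGi (hPG k)).trans hGle
    have h2 : ⨆ x, f k x ≤ k * s := ciSup_le (hfk k)
    gcongr
  calc (∫ x, Real.exp (τ * (1 - c) * (φ x - m)) ∂μ) ^ n
      = ∫ x : Fin n → X, ∏ i, Real.exp (τ * (1 - c) * (φ (x i) - m)) ∂ν := by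
        rw [integral_fintype_prod_eq_pow (fun x => Real.exp (τ * (1 - c) * (φ x - m)))]
        simp
    _ ≤ ∫ x, ∑ k ∈ Finset.range (N + 1), Real.exp (τ * (1 - c) * s - τ * c * (k * s)) *
          Real.exp (τ * PSupN α (f k) x) ∂ν := by
        refine integral_mono_of_nonneg
          (Eventually.of_forall fun x => Finset.prod_nonneg fun i _ => (Real.exp_pos _).le)
          (integrable_finsetSum _ fun k _ => (hEi k).const_mul _)
          (Eventually.of_forall fun x => ?_)
        refine le_trans ?_ (exp_mul_le_sum_exp_truncation hτ hc1 hs (hF0 x) (hFN x)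
          fun k => hfP k x)
        simp only
        rw [← Real.exp_sum, ← Finset.mul_sum, Finset.sum_sub_distrib]
        refine Real.exp_le_exp.2 (mul_le_mul_of_nonneg_left ?_ hκ.le)
        refine le_trans (le_of_eq ?_) (le_max_left (∑ i, φ (x i) - n * m) 0)
        simp
    _ = ∑ k ∈ Finset.range (N + 1), Real.exp (τ * (1 - c) * s - τ * c * (k * s)) *
          ∫ x, Real.exp (τ * PSupN α (f k) x) ∂ν := by
        rw [integral_finsetSum _ fun k _ => (hEi k).const_mul _]
        simp only [integral_const_mul]
    _ ≤ ∑ k ∈ Finset.range (N + 1), Real.exp (τ * (1 - c) * s - τ * c * (k * s)) *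
          (a * Real.exp (b * (M ^ 2 / (4 * δ) + δ * n)) * Real.exp (τ * c * (k * s))) := by
        gcongr with k _
        exact hbound k
    _ = ∑ k ∈ Finset.range (N + 1),
          a * Real.exp (τ * (1 - c) * (δ * n) + b * (M ^ 2 / (4 * δ) + δ * n)) := by
        refine Finset.sum_congr rfl fun k _ => ?_
        rw [Real.exp_sub, Real.exp_add]
        have := (Real.exp_pos (τ * c * (k * s))).ne'
        field_simp
        simp only [s, mul_assoc]
    _ = _ := by simp [s]

lemma integral_exp_le_one_of_sup_convolution_bound
    {X : Type*} [MetricSpace X] [TopologicalSpace.SeparableSpace X]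
    [MeasurableSpace X] [BorelSpace X] {α : ℝ → ℝ} (hα : IsYoung α)
    (μ : Measure X) [IsProbabilityMeasure μ]
    {τ a b c : ℝ} (hτ : 0 < τ) (ha : 0 < a) (hb : 0 < b) (hc0 : 0 ≤ c) (hc1 : c < 1)
    (H : ∀ n : ℕ, 0 < n →
      ∀ f : (Fin n → X) → ℝ, Continuous f → IsBoundedFun f → (∀ x, 0 ≤ f x) →
        ∫ x, Real.exp (τ * PSupN α f x) ∂(Measure.pi fun _ : Fin n => μ) ≤
          a * Real.exp (b * ∫ x, PSupN α f x ∂(Measure.pi fun _ : Fin n => μ)) *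
            Real.exp (τ * c * ⨆ x, f x))
    {φ : X → ℝ} (hφ : Continuous φ) {M : ℝ} (hM : ∀ x, |φ x| ≤ M) :
    ∫ x, Real.exp (τ * (1 - c) * (φ x - ∫ z, ⨆ y, (φ y - α (dist z y)) ∂μ)) ∂μ ≤ 1 := by
  have hκ : 0 < τ * (1 - c) := mul_pos hτ (by linarith)
  set Z := ∫ x, Real.exp (τ * (1 - c) * (φ x - ∫ z, ⨆ y, (φ y - α (dist z y)) ∂μ)) ∂μ
  by_contra! hZ
  have hlog : 0 < Real.log Z := Real.log_pos hZ
  set δ := Real.log Z / (2 * (τ * (1 - c) + b)) with hδ_def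
  have hδ : 0 < δ := by positivity
  obtain ⟨N, hN⟩ := exists_nat_ge (2 * M / δ)
  set K := Real.log ((N + 1) * a) + b * (M ^ 2 / (4 * δ))
  have key : ∀ n : ℕ, 0 < n → n * Real.log Z ≤ K + n * (Real.log Z / 2) := by
    intro n hn
    have h := Real.log_le_log (pow_pos (zero_lt_one.trans hZ) n)
      (pow_integral_exp_le_of_sup_convolution_bound hα μ hτ ha hb hc0 hc1 hn (H n hn) hφ hM hδ
        ((div_le_iff₀ hδ).1 hN))
    rw [Real.log_pow, ← mul_assoc, Real.log_mul (by positivity) (Real.exp_pos _).ne',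
      Real.log_exp] at h
    refine h.trans_eq ?_
    have : (τ * (1 - c) + b) * δ = Real.log Z / 2 := by
      rw [hδ_def]
      field_simp
    rw [← this]
    simp only [K]
    ring
  obtain ⟨n, hn⟩ := exists_nat_gt (2 * K / Real.log Z)
  rw [div_lt_iff₀ hlog] at hn
  have h1 := key (n + 1) n.succ_pos
  push_cast at h1
  nlinarith

theorem sup_convolution_bound_implies_transport_entropy
    {X : Type*} [MetricSpace X] [CompleteSpace X] [TopologicalSpace.SeparableSpace X]
    [MeasurableSpace X] [BorelSpace X]
    (α : ℝ → ℝ) (hα : IsYoung α)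
    (μ : Measure X) [IsProbabilityMeasure μ]
    (τ a b : ℝ) (hτ : 0 < τ) (ha : 0 < a) (hb : 0 < b)
    (c : ℝ) (hc0 : 0 ≤ c) (hc1 : c < 1)
    (H : ∀ n : ℕ, 0 < n →
      ∀ f : (Fin n → X) → ℝ, Continuous f → IsBoundedFun f → (∀ x, 0 ≤ f x) →
        ∫ x, Real.exp (τ * PSupN α f x) ∂(Measure.pi fun _ : Fin n => μ) ≤
          a * Real.exp (b * ∫ x, PSupN α f x ∂(Measure.pi fun _ : Fin n => μ)) *
            Real.exp (τ * c * ⨆ x, f x)) :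
    TransportEntropy μ α (1 / (τ * (1 - c))) := by
  intro ν hν
  have hκ : 0 < τ * (1 - c) := mul_pos hτ (by linarith)
  have hX : Nonempty X := nonempty_of_isProbabilityMeasure μ
  unfold relEnt
  split_ifs with hac
  swap
  · rw [ENNReal.mul_top (ENNReal.ofReal_pos.2 (by positivity)).ne']
    exact le_top
  rw [← ENNReal.ofReal_mul (by positivity)]
  refine transportCost_le_of_dual_le hα ν μ ?_
  rintro φ ψ hφ ⟨M, hM⟩ hψm ⟨M', hM'⟩ hφψ
  have hφM : ∀ x, φ x ≤ M := fun x => (abs_le.1 (hM x)).2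
  have hd0 : ∀ x y : X, 0 ≤ α (dist x y) := fun x y => hα.nonneg _
  have hd : ∀ x : X, α (dist x x) = 0 := fun x => by rw [dist_self, hα.zero]
  have hgm : Measurable fun z => ⨆ y, (φ y - α (dist z y)) :=
    measurable_iSup_sub_of_nonneg hd0
      (fun y => hα.continuous.comp (continuous_id.dist continuous_const)) hφM
  have hgi : Integrable (fun z => ⨆ y, (φ y - α (dist z y))) μ :=
    Integrable.of_bound hgm.aestronglyMeasurable M (Eventually.of_forall fun x =>
      abs_le.2 ⟨(abs_le.1 (hM x)).1.trans (le_iSup_sub_of_nonneg hd0 hd hφM x),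
        iSup_sub_le_of_nonneg hd0 hφM x⟩)
  have hψi : Integrable ψ μ :=
    Integrable.of_bound hψm.aestronglyMeasurable M' (Eventually.of_forall hM')
  have hφi : Integrable φ ν :=
    Integrable.of_bound hφ.aestronglyMeasurable M (Eventually.of_forall hM)
  have hgψ : ∫ z, ⨆ y, (φ y - α (dist z y)) ∂μ ≤ ∫ z, ψ z ∂μ :=
    integral_mono hgi hψi fun z => ciSup_le fun y => by
      have := hφψ y z
      rw [dist_comm] at this
      linarith
  have hone := integral_exp_le_one_of_sup_convolution_bound hα μ hτ ha hb hc0 hc1 H hφ hM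
  set m := ∫ z, ⨆ y, (φ y - α (dist z y)) ∂μ
  have hgibbs := integral_le_integral_log_rnDeriv (h := fun x => τ * (1 - c) * (φ x - m))
    hac.1 hac.2 ((hφi.sub (integrable_const m)).const_mul _)
    (Integrable.of_bound (((hφ.sub continuous_const).const_mul
      (τ * (1 - c))).rexp).aestronglyMeasurable (Real.exp (τ * (1 - c) * (M - m)))
      (Eventually.of_forall fun x => by
        rw [Real.norm_of_nonneg (Real.exp_pos _).le, Real.exp_le_exp]
        exact mul_le_mul_of_nonneg_left (sub_le_sub_right (hφM x) m) hκ.le)) hone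
  rw [integral_const_mul, integral_sub hφi (integrable_const m)] at hgibbs
  simp only [integral_const, probReal_univ, smul_eq_mul, one_mul] at hgibbs
  rw [one_div, ← div_eq_inv_mul, le_div_iff₀ hκ]
  nlinarith
end

section
/- Let p₁ ≥ 2 and p₂ > 1, and let α = α_{p₁,p₂}, where α_{p₁,p₂}(x) = |x|^{p₁} if |x| ≤ 1 and (p₁/p₂)|x|^{p₂} + 1 − p₁/p₂ if |x| > 1. Then p_α = max(p₁,p₂), and ξ_α(x) = (p_α−1)·x^{1/(p_α−1)} for all 0 < x ≤ 1. Moreover, for x ≥ 1: if p₁ ≥ p₂ then ξ_α(x) = p₁·( (1/q₂)·x^{1/(p₂−1)} + (1/q₁ − 1/q₂)·(1/x) ), and if p₁ ≤ p₂ then ξ_α(x) = max( (p₁−1)·x^{1/(p₁−1)} , (p₂−1)·x^{1/(p₂−1)} ), where q₁ = p₁/(p₁−1) and q₂ = p₂/(p₂−1). -/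
open MeasureTheory Filter Set Topology
open scoped ENNReal NNReal

noncomputable section
open Classical in
/-- The Young function `α_{p₁,p₂}`. -/
def alphaTwo (p₁ p₂ : ℝ) : ℝ → ℝ := fun x =>
  if |x| ≤ 1 then |x| ^ p₁ else p₁ / p₂ * |x| ^ p₂ + 1 - p₁ / p₂
end

section TangentLines

lemma rpow_add_mul_sub_le_rpow {p x v : ℝ} (hp : 1 ≤ p) (hx : 0 ≤ x) (hv : 0 < v) :
    v ^ p + p * v ^ (p - 1) * (x - v) ≤ x ^ p := by
  have h := one_add_mul_self_le_rpow_one_add (s := x / v - 1)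
    (by linarith [div_nonneg hx hv.le]) hp
  rw [add_sub_cancel, Real.div_rpow hx hv.le, le_div_iff₀ (Real.rpow_pos_of_pos hv p)] at h
  rw [Real.rpow_sub_one hv.ne']
  calc _ = (1 + p * (x / v - 1)) * v ^ p := by field_simp
    _ ≤ _ := h

lemma one_add_div_mul_rpow_sub_one_le {p q r : ℝ} (hq : 0 < q) (hqp : q ≤ p) (hr : 0 ≤ r) :
    1 + p / q * (r ^ q - 1) ≤ r ^ p := by
  have h := one_add_mul_self_le_rpow_one_add (s := r ^ q - 1)
    (by linarith [Real.rpow_nonneg hr q]) ((one_le_div hq).2 hqp)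
  rwa [add_sub_cancel, ← Real.rpow_mul hr, mul_div_cancel₀ _ hq.ne'] at h

lemma mul_rpow_sub_one_self {p u : ℝ} (hu : 0 < u) : u * u ^ (p - 1) = u ^ p := by
  rw [Real.rpow_sub_one hu.ne']
  field_simp

lemma mul_rpow_one_div_sub_one {p t : ℝ} (ht : 0 < t) (hp : 1 < p) :
    t * t ^ (1 / (p - 1)) = (t ^ (1 / (p - 1))) ^ p := by
  have hp' : p - 1 ≠ 0 := by linarith
  nth_rewrite 1 [← Real.rpow_one t]
  rw [← Real.rpow_mul ht.le, ← Real.rpow_add ht]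
  congr 1
  field_simp
  ring

end TangentLines

section AlphaTwo

variable {p₁ p₂ : ℝ}

lemma alphaTwo_of_le_one {x : ℝ} (hx : 0 ≤ x) (hx1 : x ≤ 1) : alphaTwo p₁ p₂ x = x ^ p₁ := by
  simp [alphaTwo, abs_of_nonneg hx, hx1]

lemma alphaTwo_of_one_le {x : ℝ} (hx : 1 ≤ x) :
    alphaTwo p₁ p₂ x = p₁ / p₂ * x ^ p₂ + 1 - p₁ / p₂ := by
  rcases hx.eq_or_lt with rfl | hx'
  · simp [alphaTwo]
  · simp [alphaTwo, abs_of_pos (one_pos.trans hx'), hx'.not_ge]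

lemma alphaTwo_abs (x : ℝ) : alphaTwo p₁ p₂ |x| = alphaTwo p₁ p₂ x := by
  simp [alphaTwo]

lemma alphaTwo_pos (hp₁ : 0 < p₁) (hp₂ : 0 < p₂) {x : ℝ} (hx : 0 < x) :
    0 < alphaTwo p₁ p₂ x := by
  rcases le_total x 1 with h | h
  · rw [alphaTwo_of_le_one hx.le h]
    positivity
  · rw [alphaTwo_of_one_le h]
    have := mul_nonneg (div_pos hp₁ hp₂).le (sub_nonneg.2 (Real.one_le_rpow h hp₂.le))
    linarith

lemma rightD_alphaTwo_of_one_le (hp₂ : p₂ ≠ 0) {u : ℝ} (hu : 1 ≤ u) :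
    rightD (alphaTwo p₁ p₂) u = p₁ * u ^ (p₂ - 1) := by
  have h := (((Real.hasDerivAt_rpow_const (x := u) (p := p₂)
    (Or.inl (by linarith))).const_mul (p₁ / p₂)).add_const 1).sub_const (p₁ / p₂)
  have h' : HasDerivWithinAt (alphaTwo p₁ p₂) (p₁ / p₂ * (p₂ * u ^ (p₂ - 1))) (Ioi u) u :=
    h.hasDerivWithinAt.congr (fun x hx => alphaTwo_of_one_le (hu.trans (le_of_lt hx)))
      (alphaTwo_of_one_le hu)
  rw [rightD, h'.derivWithin (uniqueDiffWithinAt_Ioi u)]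
  field_simp

lemma rightD_alphaTwo_of_le_one (hp₂ : p₂ ≠ 0) {u : ℝ} (hu : 0 < u) (hu1 : u ≤ 1) :
    rightD (alphaTwo p₁ p₂) u = p₁ * u ^ (p₁ - 1) := by
  rcases hu1.eq_or_lt with rfl | hu1
  · simp [rightD_alphaTwo_of_one_le hp₂]
  have h := Real.hasDerivAt_rpow_const (x := u) (p := p₁) (Or.inl hu.ne')
  have h' : HasDerivAt (alphaTwo p₁ p₂) (p₁ * u ^ (p₁ - 1)) u := by
    refine h.congr_of_eventuallyEq ?_
    filter_upwards [Ioo_mem_nhds hu hu1] with x hx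
    exact alphaTwo_of_le_one hx.1.le hx.2.le
  rw [rightD, h'.hasDerivWithinAt.derivWithin (uniqueDiffWithinAt_Ioi u)]

lemma rightD_alphaTwo_nonneg (hp₁ : 0 ≤ p₁) (hp₂ : p₂ ≠ 0) {u : ℝ} (hu : 0 < u) :
    0 ≤ rightD (alphaTwo p₁ p₂) u := by
  rcases le_total u 1 with h | h
  · rw [rightD_alphaTwo_of_le_one hp₂ hu h]
    positivity
  · rw [rightD_alphaTwo_of_one_le hp₂ h]
    positivity

/-- The graph of `alphaTwo p₁ p₂` lies above its tangent lines. -/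
lemma mul_rightD_sub_alphaTwo_le (hp₁ : 1 ≤ p₁) (hp₂ : 1 ≤ p₂) {z u : ℝ} (hz : 0 ≤ z)
    (hu : 0 < u) :
    z * rightD (alphaTwo p₁ p₂) u - alphaTwo p₁ p₂ z ≤
      u * rightD (alphaTwo p₁ p₂) u - alphaTwo p₁ p₂ u := by
  have hp₂' : p₂ ≠ 0 := by linarith
  have hB : 0 ≤ p₁ / p₂ := by positivity
  have outer {a v : ℝ} (ha : 0 ≤ a) (hv : 0 < v) :
      p₁ / p₂ * v ^ p₂ + p₁ * v ^ (p₂ - 1) * (a - v) ≤ p₁ / p₂ * a ^ p₂ := by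
    calc _ = p₁ / p₂ * (v ^ p₂ + p₂ * v ^ (p₂ - 1) * (a - v)) := by field_simp
      _ ≤ _ := by gcongr; exact rpow_add_mul_sub_le_rpow hp₂ ha hv
  rcases le_total u 1 with h | h
  · rw [rightD_alphaTwo_of_le_one hp₂' hu h, alphaTwo_of_le_one hu.le h]
    rcases le_total z 1 with h' | h'
    · rw [alphaTwo_of_le_one hz h']
      linarith [rpow_add_mul_sub_le_rpow hp₁ hz hu]
    · rw [alphaTwo_of_one_le h']
      have h1 := outer hz one_pos
      have h2 := rpow_add_mul_sub_le_rpow hp₁ zero_le_one hu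
      have h3 : u ^ (p₁ - 1) ≤ 1 := Real.rpow_le_one hu.le h (by linarith)
      have h4 : p₁ * u ^ (p₁ - 1) * (z - 1) ≤ p₁ * 1 * (z - 1) := by
        gcongr
      simp only [Real.one_rpow] at h1 h2
      linarith
  · rw [rightD_alphaTwo_of_one_le hp₂' h, alphaTwo_of_one_le h]
    rcases le_total z 1 with h' | h'
    · rw [alphaTwo_of_le_one hz h']
      have h1 := outer zero_le_one hu
      have h2 := rpow_add_mul_sub_le_rpow hp₁ hz one_pos
      have h3 : 1 ≤ u ^ (p₂ - 1) := Real.one_le_rpow h (by linarith)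
      have h4 : p₁ * 1 * (1 - z) ≤ p₁ * u ^ (p₂ - 1) * (1 - z) := by
        gcongr
      simp only [Real.one_rpow] at h1 h2
      linarith
    · rw [alphaTwo_of_one_le h']
      linarith [outer hz hu]

lemma mul_rightD_alphaTwo_le (hp₁ : 0 < p₁) (hp₂ : 0 < p₂) {u : ℝ} (hu : 0 < u) :
    u * rightD (alphaTwo p₁ p₂) u ≤ max p₁ p₂ * alphaTwo p₁ p₂ u := by
  rcases le_total u 1 with h | h
  · rw [rightD_alphaTwo_of_le_one hp₂.ne' hu h, alphaTwo_of_le_one hu.le h, mul_left_comm,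
      mul_rpow_sub_one_self hu]
    gcongr
    exact le_max_left _ _
  · rw [rightD_alphaTwo_of_one_le hp₂.ne' h, alphaTwo_of_one_le h, mul_left_comm,
      mul_rpow_sub_one_self hu]
    have hw : 1 ≤ u ^ p₂ := Real.one_le_rpow h hp₂.le
    rcases le_total p₁ p₂ with hle | hle
    · rw [max_eq_right hle]
      have : p₂ * (p₁ / p₂ * u ^ p₂ + 1 - p₁ / p₂) = p₁ * u ^ p₂ + (p₂ - p₁) := by
        field_simp
        ring
      linarith
    · rw [max_eq_left hle]
      have : 0 ≤ p₁ * ((p₁ / p₂ - 1) * (u ^ p₂ - 1)) := by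
        have := (one_le_div hp₂).2 hle
        exact mul_nonneg hp₁.le (mul_nonneg (by linarith) (by linarith))
      linarith

lemma alphaTwo_mul_le_of_one_le (hp₁ : 0 < p₁) (hp₂ : 0 < p₂) {w r : ℝ} (hw : 1 ≤ w)
    (hr : 1 ≤ r) :
    alphaTwo p₁ p₂ (r * w) ≤ r ^ max p₁ p₂ * alphaTwo p₁ p₂ w := by
  rw [alphaTwo_of_one_le (one_le_mul_of_one_le_of_one_le hr hw), alphaTwo_of_one_le hw,
    Real.mul_rpow (by linarith) (by linarith)]
  have hwp : 1 ≤ w ^ p₂ := Real.one_le_rpow hw hp₂.le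
  have hrp : 1 ≤ r ^ p₂ := Real.one_le_rpow hr hp₂.le
  rcases le_total p₁ p₂ with hle | hle
  · rw [max_eq_right hle]
    have : p₁ / p₂ ≤ 1 := (div_le_one hp₂).2 hle
    nlinarith
  · rw [max_eq_left hle]
    have hB : 0 ≤ p₁ / p₂ := by positivity
    have h1 := one_add_div_mul_rpow_sub_one_le hp₂ hle (zero_le_one.trans hr)
    have h2 : r ^ p₂ ≤ r ^ p₁ := Real.rpow_le_rpow_of_exponent_le hr hle
    have h3 := mul_nonneg hB (mul_nonneg (sub_nonneg.2 h2) (sub_nonneg.2 hwp))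
    linarith

/-- The function `x ↦ alphaTwo p₁ p₂ x / x ^ max p₁ p₂` is nonincreasing. -/
lemma rpow_mul_alphaTwo_le (hp₁ : 0 < p₁) (hp₂ : 0 < p₂) {τ z : ℝ} (hτ : 0 < τ) (hτ1 : τ ≤ 1)
    (hz : 0 ≤ z) :
    τ ^ max p₁ p₂ * alphaTwo p₁ p₂ z ≤ alphaTwo p₁ p₂ (τ * z) := by
  have inner {σ x : ℝ} (hσ : 0 < σ) (hσ1 : σ ≤ 1) (hx : 0 ≤ x) (hx1 : x ≤ 1) :
      σ ^ max p₁ p₂ * alphaTwo p₁ p₂ x ≤ alphaTwo p₁ p₂ (σ * x) := by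
    rw [alphaTwo_of_le_one hx hx1,
      alphaTwo_of_le_one (by positivity) (mul_le_one₀ hσ1 hx hx1), Real.mul_rpow hσ.le hx]
    exact mul_le_mul_of_nonneg_right
      (Real.rpow_le_rpow_of_exponent_ge hσ hσ1 (le_max_left _ _)) (Real.rpow_nonneg hx p₁)
  rcases le_total z 1 with h | h
  · exact inner hτ hτ1 hz h
  have hz0 : 0 < z := by linarith
  rcases le_total 1 (τ * z) with h' | h'
  · have := alphaTwo_mul_le_of_one_le hp₁ hp₂ h' ((one_le_inv₀ hτ).2 hτ1)
    rw [inv_mul_cancel_left₀ hτ.ne', Real.inv_rpow hτ.le] at this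
    rwa [← le_inv_mul_iff₀ (by positivity)]
  · have h1 := alphaTwo_mul_le_of_one_le hp₁ hp₂ le_rfl h
    have h2 := inner (mul_pos hτ hz0) h' zero_le_one le_rfl
    rw [mul_one] at h1 h2
    rw [Real.mul_rpow hτ.le hz] at h2
    calc _ ≤ τ ^ max p₁ p₂ * (z ^ max p₁ p₂ * alphaTwo p₁ p₂ 1) := by gcongr
      _ ≤ _ := by rwa [← mul_assoc]

lemma rpow_le_alphaTwo (hp₁ : 0 < p₁) (hle : p₁ ≤ p₂) {x : ℝ} (hx : 0 ≤ x) :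
    x ^ p₁ ≤ alphaTwo p₁ p₂ x := by
  have hp₂ : 0 < p₂ := by linarith
  rcases le_total x 1 with h | h
  · rw [alphaTwo_of_le_one hx h]
  · rw [alphaTwo_of_one_le h]
    have h1 := mul_le_mul_of_nonneg_left (one_add_div_mul_rpow_sub_one_le hp₁ hle hx)
      (div_pos hp₁ hp₂).le
    have h2 : p₁ / p₂ * (1 + p₂ / p₁ * (x ^ p₁ - 1)) = p₁ / p₂ + (x ^ p₁ - 1) := by
      field_simp
    linarith

end AlphaTwo

section Transforms

variable {p₁ p₂ : ℝ}

lemma xiAlpha_alphaTwo_le (hp₁ : 0 < p₁) (hp₂ : 0 < p₂) {t R : ℝ} (ht : 0 < t)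
    (h : ∀ u > 0, ∀ x ≥ 0, x * (t * rightD (alphaTwo p₁ p₂) u) - alphaTwo p₁ p₂ x ≤
      t * alphaTwo p₁ p₂ u * R) :
    xiAlpha (alphaTwo p₁ p₂) t ≤ ENNReal.ofReal R := by
  refine iSup_le fun ⟨u, hu⟩ => ENNReal.div_le_of_le_mul ?_
  have hα := alphaTwo_pos hp₁ hp₂ hu
  rw [mul_comm (ENNReal.ofReal R), ← ENNReal.ofReal_mul (mul_pos ht hα).le]
  refine iSup_le fun x => ENNReal.ofReal_le_ofReal ?_
  refine le_trans ?_ (h u hu |x| (abs_nonneg x))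
  have hD := rightD_alphaTwo_nonneg hp₁.le hp₂.ne' hu
  rw [alphaTwo_abs]
  gcongr
  exact le_abs_self x

lemma ofReal_le_xiAlpha_alphaTwo (hp₁ : 0 < p₁) (hp₂ : 0 < p₂) {t R u : ℝ} (ht : 0 < t)
    (hu : 0 < u) (x : ℝ)
    (h : t * alphaTwo p₁ p₂ u * R ≤
      x * (t * rightD (alphaTwo p₁ p₂) u) - alphaTwo p₁ p₂ x) :
    ENNReal.ofReal R ≤ xiAlpha (alphaTwo p₁ p₂) t := by
  have hα := alphaTwo_pos hp₁ hp₂ hu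
  refine le_trans ?_ (le_iSup (fun u : {u : ℝ // 0 < u} =>
    legendre (alphaTwo p₁ p₂) (t * rightD (alphaTwo p₁ p₂) u) /
      ENNReal.ofReal (t * alphaTwo p₁ p₂ u)) ⟨u, hu⟩)
  rw [ENNReal.le_div_iff_mul_le (Or.inl (by simpa using by positivity))
    (Or.inl ENNReal.ofReal_ne_top), mul_comm, ← ENNReal.ofReal_mul (by positivity)]
  exact (ENNReal.ofReal_le_ofReal h).trans
    (le_iSup (fun x : ℝ => ENNReal.ofReal (x * (t * rightD (alphaTwo p₁ p₂) u) -
      alphaTwo p₁ p₂ x)) x)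

lemma tendsto_linear_div_linear_rpow {p : ℝ} (hp : 0 < p) (a b : ℝ) {c : ℝ} (hc : c ≠ 0)
    (d : ℝ) :
    Tendsto (fun u : ℝ => (a * u ^ p + b) / (c * u ^ p + d)) atTop (𝓝 (a / c)) := by
  have hinv := (tendsto_rpow_atTop hp).inv_tendsto_atTop
  have h := ((hinv.const_mul b).const_add a).div ((hinv.const_mul d).const_add c) (by simpa)
  simp only [mul_zero, add_zero] at h
  refine h.congr' ?_
  filter_upwards [eventually_gt_atTop 0] with u hu
  have : u ^ p ≠ 0 := (Real.rpow_pos_of_pos hu p).ne'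
  simp only [Pi.div_apply, Pi.inv_apply]
  rw [← mul_div_mul_right _ _ this]
  field_simp

lemma pAlpha_alphaTwo (hp₁ : 1 < p₁) (hp₂ : 1 < p₂) :
    pAlpha (alphaTwo p₁ p₂) = max p₁ p₂ := by
  have h₁ : 0 < p₁ := by linarith
  have h₂ : 0 < p₂ := by linarith
  have hub : max p₁ p₂ ∈
      upperBounds {r : ℝ | ∃ x > 0, r = x * rightD (alphaTwo p₁ p₂) x / alphaTwo p₁ p₂ x} := by
    rintro _ ⟨x, hx, rfl⟩
    exact (div_le_iff₀ (alphaTwo_pos h₁ h₂ hx)).2 (mul_rightD_alphaTwo_le h₁ h₂ hx)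
  refine IsLUB.csSup_eq ⟨hub, fun M hM => max_le ?_ ?_⟩ ⟨_, 1, one_pos, rfl⟩
  · refine hM ⟨1, one_pos, ?_⟩
    simp [rightD_alphaTwo_of_one_le h₂.ne', alphaTwo_of_one_le]
  · have h := tendsto_linear_div_linear_rpow h₂ p₁ 0 (div_pos h₁ h₂).ne' (1 - p₁ / p₂)
    rw [div_div_cancel₀ h₁.ne'] at h
    refine le_of_tendsto h ?_
    filter_upwards [eventually_ge_atTop 1] with u hu
    refine hM ⟨u, by linarith, ?_⟩
    rw [rightD_alphaTwo_of_one_le h₂.ne' hu, alphaTwo_of_one_le hu, mul_left_comm,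
      mul_rpow_sub_one_self (by linarith), add_zero, add_sub_assoc]

lemma xiAlpha_alphaTwo_le_of_le_one (hp₁ : 1 < p₁) (hp₂ : 1 < p₂) {t : ℝ} (ht : 0 < t)
    (ht1 : t ≤ 1) :
    xiAlpha (alphaTwo p₁ p₂) t ≤
      ENNReal.ofReal ((max p₁ p₂ - 1) * t ^ (1 / (max p₁ p₂ - 1))) := by
  have h₁ : 0 < p₁ := by linarith
  have h₂ : 0 < p₂ := by linarith
  have hP : 1 < max p₁ p₂ := lt_max_of_lt_left hp₁
  refine xiAlpha_alphaTwo_le h₁ h₂ ht fun u hu x hx => ?_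
  have hpow := mul_rpow_one_div_sub_one ht hP
  have hτ1 : t ^ (1 / (max p₁ p₂ - 1)) ≤ 1 :=
    Real.rpow_le_one ht.le ht1 (one_div_nonneg.2 (by linarith))
  have hτ : 0 < t ^ (1 / (max p₁ p₂ - 1)) := by positivity
  generalize t ^ (1 / (max p₁ p₂ - 1)) = τ at *
  obtain ⟨z, rfl⟩ : ∃ z, x = τ * z := ⟨x / τ, by field_simp⟩
  have hz : 0 ≤ z := nonneg_of_mul_nonneg_right hx hτ
  have h1 := rpow_mul_alphaTwo_le h₁ h₂ hτ hτ1 hz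
  have h2 := mul_rightD_sub_alphaTwo_le hp₁.le hp₂.le hz hu
  have h3 := mul_rightD_alphaTwo_le h₁ h₂ hu
  have h4 : t * τ * (z * rightD (alphaTwo p₁ p₂) u - alphaTwo p₁ p₂ z) ≤
      t * τ * ((max p₁ p₂ - 1) * alphaTwo p₁ p₂ u) := by
    gcongr
    linarith
  rw [← hpow] at h1
  linarith

lemma xiAlpha_alphaTwo_ge_left (hp₁ : 1 < p₁) (hp₂ : 1 < p₂) {t : ℝ} (ht : 0 < t) :
    ENNReal.ofReal ((p₁ - 1) * t ^ (1 / (p₁ - 1))) ≤ xiAlpha (alphaTwo p₁ p₂) t := by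
  have h₁ : 0 < p₁ := by linarith
  have h₂ : 0 < p₂ := by linarith
  have hpow := mul_rpow_one_div_sub_one ht hp₁
  have hτ : 0 < t ^ (1 / (p₁ - 1)) := by positivity
  generalize t ^ (1 / (p₁ - 1)) = τ at *
  obtain ⟨u, hu, hu1, hτu⟩ : ∃ u, 0 < u ∧ u ≤ 1 ∧ τ * u ≤ 1 := by
    refine ⟨min 1 τ⁻¹, by positivity, min_le_left _ _, ?_⟩
    calc _ ≤ τ * τ⁻¹ := by gcongr; exact min_le_right _ _
      _ = 1 := mul_inv_cancel₀ hτ.ne'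
  refine ofReal_le_xiAlpha_alphaTwo h₁ h₂ ht hu (τ * u) (le_of_eq ?_)
  rw [rightD_alphaTwo_of_le_one h₂.ne' hu hu1, alphaTwo_of_le_one hu.le hu1,
    alphaTwo_of_le_one (by positivity) hτu, Real.mul_rpow hτ.le hu.le, ← hpow,
    ← mul_rpow_sub_one_self (p := p₁) hu]
  ring

lemma xiAlpha_alphaTwo_ge_right (hp₁ : 1 < p₁) (hp₂ : 1 < p₂) {t : ℝ} (ht : 0 < t) :
    ENNReal.ofReal ((p₂ - 1) * t ^ (1 / (p₂ - 1))) ≤ xiAlpha (alphaTwo p₁ p₂) t := by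
  have h₁ : 0 < p₁ := by linarith
  have h₂ : 0 < p₂ := by linarith
  have hpow := mul_rpow_one_div_sub_one ht hp₂
  have hτ : 0 < t ^ (1 / (p₂ - 1)) := by positivity
  generalize t ^ (1 / (p₂ - 1)) = τ at *
  have hlim := tendsto_linear_div_linear_rpow h₂ ((p₁ - p₁ / p₂) * (t * τ)) (p₁ / p₂ - 1)
    (mul_pos ht (div_pos h₁ h₂)).ne' (t * (1 - p₁ / p₂))
  have hval : (p₁ - p₁ / p₂) * (t * τ) / (t * (p₁ / p₂)) = (p₂ - 1) * τ := by
    field_simp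
  rw [hval] at hlim
  refine le_of_tendsto (ENNReal.tendsto_ofReal hlim) ?_
  filter_upwards [eventually_ge_atTop 1, eventually_ge_atTop τ⁻¹] with u hu hu'
  have hu0 : 0 < u := by linarith
  have hτu : 1 ≤ τ * u := (inv_le_iff_one_le_mul₀' hτ).1 hu'
  refine ofReal_le_xiAlpha_alphaTwo h₁ h₂ ht hu0 (τ * u) (le_of_eq ?_)
  have hα := mul_pos ht (alphaTwo_pos h₁ h₂ hu0)
  have hden : t * (p₁ / p₂) * u ^ p₂ + t * (1 - p₁ / p₂) = t * alphaTwo p₁ p₂ u := by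
    rw [alphaTwo_of_one_le hu]
    ring
  rw [hden, mul_div_cancel₀ _ hα.ne', rightD_alphaTwo_of_one_le h₂.ne' hu,
    alphaTwo_of_one_le hτu, Real.mul_rpow hτ.le hu0.le, ← hpow,
    ← mul_rpow_sub_one_self (p := p₂) hu0]
  ring

lemma xiAlpha_alphaTwo_of_ge (hp₂ : 1 < p₂) (hle : p₂ ≤ p₁) {t : ℝ} (ht : 1 ≤ t) :
    xiAlpha (alphaTwo p₁ p₂) t =
      ENNReal.ofReal (p₁ * ((p₂ - 1) / p₂ * t ^ (1 / (p₂ - 1)) +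
        ((p₁ - 1) / p₁ - (p₂ - 1) / p₂) * (1 / t))) := by
  have hp₁ : 1 < p₁ := by linarith
  have h₁ : 0 < p₁ := by linarith
  have h₂ : 0 < p₂ := by linarith
  have ht0 : 0 < t := by linarith
  have hpow := mul_rpow_one_div_sub_one ht0 hp₂
  have hτ1 : 1 ≤ t ^ (1 / (p₂ - 1)) := Real.one_le_rpow ht (one_div_nonneg.2 (by linarith))
  have hτt : (t ^ (1 / (p₂ - 1))) ^ (p₂ - 1) = t := by
    rw [← Real.rpow_mul ht0.le, one_div_mul_cancel (by linarith), Real.rpow_one]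
  generalize t ^ (1 / (p₂ - 1)) = τ at *
  have hτ : 0 < τ := by linarith
  set R := p₁ * ((p₂ - 1) / p₂ * τ + ((p₁ - 1) / p₁ - (p₂ - 1) / p₂) * (1 / t)) with hR
  have htR : t * R = (p₁ - p₁ / p₂) * (t * τ) + (p₁ / p₂ - 1) := by
    rw [hR]
    field_simp
    ring
  have hα1 : alphaTwo p₁ p₂ 1 = 1 := by simp [alphaTwo_of_one_le]
  have hDτ : rightD (alphaTwo p₁ p₂) τ = t * p₁ := by
    rw [rightD_alphaTwo_of_one_le h₂.ne' hτ1, hτt, mul_comm]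
  have hvalue : τ * (t * p₁) - alphaTwo p₁ p₂ τ = t * R := by
    rw [alphaTwo_of_one_le hτ1, ← hpow, htR]
    ring
  apply le_antisymm
  · refine xiAlpha_alphaTwo_le h₁ h₂ ht0 fun u hu x hx => ?_
    rcases le_total u 1 with hu1 | hu1
    · rw [rightD_alphaTwo_of_le_one h₂.ne' hu hu1, alphaTwo_of_le_one hu.le hu1]
      obtain ⟨z, rfl⟩ : ∃ z, x = u * z := ⟨x / u, by field_simp⟩
      have hz : 0 ≤ z := nonneg_of_mul_nonneg_right hx hu
      have h1 := rpow_mul_alphaTwo_le h₁ h₂ hu hu1 hz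
      have h2 := mul_rightD_sub_alphaTwo_le hp₁.le hp₂.le hz hτ
      rw [hDτ, hvalue] at h2
      rw [max_eq_left hle] at h1
      have h3 := mul_le_mul_of_nonneg_left h2 (Real.rpow_nonneg hu.le p₁)
      have h4 : u * z * (t * (p₁ * u ^ (p₁ - 1))) = u ^ p₁ * (z * (t * p₁)) := by
        rw [← mul_rpow_sub_one_self (p := p₁) hu]
        ring
      linarith
    · have hτu : 1 ≤ τ * u := one_le_mul_of_one_le_of_one_le hτ1 hu1
      have h1 := mul_rightD_sub_alphaTwo_le hp₁.le hp₂.le hx (mul_pos hτ hu)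
      rw [rightD_alphaTwo_of_one_le h₂.ne' hτu, mul_left_comm (τ * u),
        mul_rpow_sub_one_self (mul_pos hτ hu), alphaTwo_of_one_le hτu,
        Real.mul_rpow hτ.le hu.le, Real.mul_rpow hτ.le hu.le, hτt, ← hpow] at h1
      rw [rightD_alphaTwo_of_one_le h₂.ne' hu1, mul_right_comm, htR, alphaTwo_of_one_le hu1]
      have hw : 1 ≤ u ^ p₂ := Real.one_le_rpow hu1 h₂.le
      have hB : 1 ≤ p₁ / p₂ := (one_le_div h₂).2 hle
      have hA : 0 ≤ (p₁ - p₁ / p₂) * (t * τ) :=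
        mul_nonneg (sub_nonneg.2 (div_le_self h₁.le hp₂.le)) (by positivity)
      have h2 := mul_nonneg (mul_nonneg (sub_nonneg.2 hB) (sub_nonneg.2 hw))
        (add_nonneg hA (zero_le_one.trans hB))
      linarith
  · refine ofReal_le_xiAlpha_alphaTwo h₁ h₂ ht0 one_pos τ (le_of_eq ?_)
    rw [rightD_alphaTwo_of_one_le h₂.ne' le_rfl, hα1, Real.one_rpow, mul_one, mul_one, hvalue]

lemma xiAlpha_alphaTwo_le_of_le (hp₁ : 1 < p₁) (hle : p₁ ≤ p₂) {t : ℝ} (ht : 1 ≤ t) :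
    xiAlpha (alphaTwo p₁ p₂) t ≤
      ENNReal.ofReal (max ((p₁ - 1) * t ^ (1 / (p₁ - 1))) ((p₂ - 1) * t ^ (1 / (p₂ - 1)))) := by
  have hp₂ : 1 < p₂ := by linarith
  have h₁ : 0 < p₁ := by linarith
  have h₂ : 0 < p₂ := by linarith
  have ht0 : 0 < t := by linarith
  have hroot {p : ℝ} (hp : 1 < p) : (t ^ (1 / (p - 1))) ^ (p - 1) = t := by
    rw [← Real.rpow_mul ht0.le, one_div_mul_cancel (by linarith), Real.rpow_one]
  refine xiAlpha_alphaTwo_le h₁ h₂ ht0 fun u hu x hx => ?_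
  have hα := mul_pos ht0 (alphaTwo_pos h₁ h₂ hu)
  rcases le_total u 1 with hu1 | hu1
  · refine le_trans ?_ (mul_le_mul_of_nonneg_left (le_max_left _ _) hα.le)
    have hpow := mul_rpow_one_div_sub_one ht0 hp₁
    have hτt := hroot hp₁
    have hτ : 0 < t ^ (1 / (p₁ - 1)) := by positivity
    generalize t ^ (1 / (p₁ - 1)) = τ at *
    have h1 := rpow_add_mul_sub_le_rpow hp₁.le hx (mul_pos hτ hu)
    have h2 := rpow_le_alphaTwo h₁ hle hx
    rw [Real.mul_rpow hτ.le hu.le, Real.mul_rpow hτ.le hu.le, hτt, ← hpow,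
      ← mul_rpow_sub_one_self (p := p₁) hu] at h1
    rw [rightD_alphaTwo_of_le_one h₂.ne' hu hu1, alphaTwo_of_le_one hu.le hu1,
      ← mul_rpow_sub_one_self (p := p₁) hu]
    linarith
  · refine le_trans ?_ (mul_le_mul_of_nonneg_left (le_max_right _ _) hα.le)
    have hpow := mul_rpow_one_div_sub_one ht0 hp₂
    have hτt := hroot hp₂
    have hτ1 : 1 ≤ t ^ (1 / (p₂ - 1)) := Real.one_le_rpow ht (one_div_nonneg.2 (by linarith))
    generalize t ^ (1 / (p₂ - 1)) = τ at *
    have hτ : 0 < τ := by linarith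
    have hτu : 1 ≤ τ * u := one_le_mul_of_one_le_of_one_le hτ1 hu1
    have h1 := mul_rightD_sub_alphaTwo_le hp₁.le hp₂.le hx (mul_pos hτ hu)
    rw [rightD_alphaTwo_of_one_le h₂.ne' hτu, mul_left_comm (τ * u),
      mul_rpow_sub_one_self (mul_pos hτ hu), alphaTwo_of_one_le hτu,
      Real.mul_rpow hτ.le hu.le, Real.mul_rpow hτ.le hu.le, hτt, ← hpow] at h1
    rw [rightD_alphaTwo_of_one_le h₂.ne' hu1, alphaTwo_of_one_le hu1]
    have hB : p₁ / p₂ ≤ 1 := (div_le_one h₂).2 hle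
    have h2 : 0 ≤ (1 - p₁ / p₂) * ((p₂ - 1) * (t * τ)) :=
      mul_nonneg (by linarith) (mul_nonneg (by linarith) (by positivity))
    have h3 : p₁ = p₁ / p₂ * p₂ := by field_simp
    have h4 : p₁ * (t * τ * u ^ p₂) = p₁ / p₂ * p₂ * (t * τ * u ^ p₂) := by rw [← h3]
    linarith

end Transforms

theorem xiAlpha_alphaTwo (p₁ p₂ : ℝ) (hp₁ : 2 ≤ p₁) (hp₂ : 1 < p₂) :
    pAlpha (alphaTwo p₁ p₂) = max p₁ p₂ ∧
    (∀ x : ℝ, 0 < x → x ≤ 1 →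
      xiAlpha (alphaTwo p₁ p₂) x =
        ENNReal.ofReal ((max p₁ p₂ - 1) * x ^ (1 / (max p₁ p₂ - 1)))) ∧
    (∀ x : ℝ, 1 ≤ x →
      (p₂ ≤ p₁ →
        xiAlpha (alphaTwo p₁ p₂) x =
          ENNReal.ofReal (p₁ * ((p₂ - 1) / p₂ * x ^ (1 / (p₂ - 1)) +
            ((p₁ - 1) / p₁ - (p₂ - 1) / p₂) * (1 / x)))) ∧
      (p₁ ≤ p₂ →
        xiAlpha (alphaTwo p₁ p₂) x =
          ENNReal.ofReal (max ((p₁ - 1) * x ^ (1 / (p₁ - 1)))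
            ((p₂ - 1) * x ^ (1 / (p₂ - 1)))))) := by
  have h₁ : 1 < p₁ := by linarith
  refine ⟨pAlpha_alphaTwo h₁ hp₂, fun x hx hx1 => ?_, fun x hx => ⟨fun hle => ?_, fun hle => ?_⟩⟩
  · refine le_antisymm (xiAlpha_alphaTwo_le_of_le_one h₁ hp₂ hx hx1) ?_
    rcases le_total p₁ p₂ with hle | hle
    · rw [max_eq_right hle]
      exact xiAlpha_alphaTwo_ge_right h₁ hp₂ hx
    · rw [max_eq_left hle]
      exact xiAlpha_alphaTwo_ge_left h₁ hp₂ hx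
  · exact xiAlpha_alphaTwo_of_ge hp₂ hle hx
  · have hx0 : 0 < x := by linarith
    refine le_antisymm (xiAlpha_alphaTwo_le_of_le h₁ hle hx) ?_
    rw [ENNReal.ofReal_max]
    exact max_le (xiAlpha_alphaTwo_ge_left h₁ hp₂ hx0) (xiAlpha_alphaTwo_ge_right h₁ hp₂ hx0)
end

section
/- Let (X,d) be a metric space and α a Young function. For every integer n ∈ ℕ* and every bounded function f : X^n → ℝ, the function Q_{α,n} f is separately locally Lipschitz on X^n, i.e., for every x ∈ X^n and every index 1 ≤ i ≤ n, the partial map u ↦ Q_{α,n}f(x₁,…,x_{i−1},u,x_{i+1},…,x_n) is locally Lipschitz on X. Here Q_{α,n} f(x) = inf_{y∈X^n} { f(y) + Σ_{i=1}^n α(d(x_i,y_i)) }. -/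
open MeasureTheory Filter Set Topology
open scoped ENNReal NNReal

/-- A Young function grows at least linearly, so its sublevel sets in `[0,∞)` are bounded. -/
lemma IsYoung.le_one_add_div {α : ℝ → ℝ} (hα : IsYoung α) {t C : ℝ} (hC : 0 ≤ C)
    (h : α t ≤ C) : t ≤ 1 + C / α 1 := by
  have h1 : 0 < α 1 := by
    simpa [hα.zero] using hα.mono (by simp : (0 : ℝ) ∈ Ici 0) (by simp : (1 : ℝ) ∈ Ici 0) one_pos
  by_contra! hlt
  have hdiv : 0 ≤ C / α 1 := by positivity
  have ht : 1 < t := by linarith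
  have hs := hα.convex.slope_mono_adjacent (mem_univ 0) (mem_univ t) one_pos ht
  rw [hα.zero, sub_zero, sub_zero, div_one, le_div_iff₀ (by linarith)] at hs
  have : C / α 1 < t - 1 := by linarith
  rw [div_lt_iff₀ h1] at this
  nlinarith

/-- One-sided Lipschitz estimate for a Young function on bounded intervals of `[0,∞)`. -/
lemma IsYoung.le_add_mul {α : ℝ → ℝ} (hα : IsYoung α) {s t R δ : ℝ} (hs : 0 ≤ s)
    (hδ : 0 ≤ δ) (hst : s ≤ t + δ) (hsR : s ≤ R) : α s ≤ α t + α (R + 1) * δ := by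
  have hK := hα.nonneg (R + 1)
  rcases le_or_gt s t with h | h
  · have := hα.mono.monotoneOn (mem_Ici.2 hs) (mem_Ici.2 (hs.trans h)) h
    nlinarith
  · have hz : s < R + 1 := by linarith
    have hsl := hα.convex.slope_mono_adjacent (mem_univ t) (mem_univ (R + 1)) h hz
    have hle : (α (R + 1) - α s) / (R + 1 - s) ≤ α (R + 1) := by
      rw [div_le_iff₀ (by linarith)]
      nlinarith [hα.nonneg s]
    have := hsl.trans hle
    rw [div_le_iff₀ (by linarith)] at this
    nlinarith

/-- The functions in the infimum defining `QInfN` are bounded below. -/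
lemma bddBelow_range_qInfN {X : Type*} [MetricSpace X] {α : ℝ → ℝ} (hα : IsYoung α) {n : ℕ}
    {f : (Fin n → X) → ℝ} {M : ℝ} (hM : ∀ y, |f y| ≤ M) (x : Fin n → X) :
    BddBelow (range fun y : Fin n → X => f y + ∑ j, α (dist (x j) (y j))) := by
  refine ⟨-M, ?_⟩
  rintro _ ⟨y, rfl⟩
  have := Finset.sum_nonneg fun j (_ : j ∈ Finset.univ) => hα.nonneg (dist (x j) (y j))
  have := (abs_le.1 (hM y)).1
  dsimp only
  linarith

theorem qInfN_separately_locally_lipschitz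
    {X : Type*} [MetricSpace X]
    (α : ℝ → ℝ) (hα : IsYoung α)
    (n : ℕ) (hn : 0 < n) (f : (Fin n → X) → ℝ) (hf : IsBoundedFun f)
    (x : Fin n → X) (i : Fin n) :
    LocallyLipschitz fun u : X => QInfN α f (Function.update x i u) := by
  intro u₀
  obtain ⟨M, hM⟩ := hf
  have hM0 : 0 ≤ M := (abs_nonneg _).trans (hM x)
  set R : ℝ := 1 + (2 * M + 1) / α 1 + 2
  refine ⟨⟨α (R + 1), hα.nonneg _⟩, Metric.ball u₀ 1, Metric.ball_mem_nhds _ one_pos,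
    LipschitzOnWith.of_le_add_mul _ fun v hv u hu => ?_⟩
  have hvu : dist v u ≤ 2 := by
    have := dist_triangle_right v u u₀
    rw [Metric.mem_ball] at hv hu
    linarith
  refine le_of_forall_pos_le_add fun ε hε => ?_
  set w := Function.update x i u
  have hQ : QInfN α f w ≤ M := by
    refine (ciInf_le (bddBelow_range_qInfN hα hM w) w).trans ?_
    simpa [hα.zero] using (abs_le.1 (hM w)).2
  have : Nonempty (Fin n → X) := ⟨x⟩
  obtain ⟨y, hy⟩ := exists_lt_of_ciInf_lt
    (show QInfN α f w < QInfN α f w + min ε 1 from lt_add_of_pos_right _ (lt_min hε one_pos))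
  have hyε := min_le_left ε 1
  have hy1 := min_le_right ε 1
  have hd : dist u (y i) ≤ 1 + (2 * M + 1) / α 1 := by
    refine hα.le_one_add_div (by linarith) ?_
    have hsingle := Finset.single_le_sum (f := fun j => α (dist (w j) (y j)))
      (fun j _ => hα.nonneg _) (Finset.mem_univ i)
    have hwi : w i = u := Function.update_self ..
    simp only [hwi] at hsingle
    have := (abs_le.1 (hM y)).1
    linarith
  have hsum : ∑ j, α (dist (Function.update x i v j) (y j)) ≤
      ∑ j, α (dist (w j) (y j)) + α (R + 1) * dist v u := by
    calc _ ≤ ∑ j, (α (dist (w j) (y j)) + if j = i then α (R + 1) * dist v u else 0) := by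
          refine Finset.sum_le_sum fun j _ => ?_
          by_cases hj : j = i
          · subst hj
            have htri := dist_triangle v u (y j)
            simp only [w, Function.update_self, if_true]
            exact hα.le_add_mul dist_nonneg dist_nonneg (by linarith) (by linarith)
          · simp [w, hj]
      _ = _ := by simp [Finset.sum_add_distrib]
  have hv' := ciInf_le (bddBelow_range_qInfN hα hM (Function.update x i v)) y
  change QInfN α f (Function.update x i v) ≤ QInfN α f w + α (R + 1) * dist v u + ε
  change QInfN α f (Function.update x i v) ≤ _ at hv'
  linarith
end
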